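/- arXiv:1111.0250 — 8 statements merged into one kernel-verified Lean document; each statement's English description precedes it below -/
import Mathlib

section
/- Let (a_n)_{n≥0} be a Hausdorff moment sequence, i.e. a_n = ∫_0^1 t^n dμ(t) for some finite positive Borel measure μ on [0,1], and assume μ ≠ 0. Then the sequence (b_n)_{n≥0} defined by b_n = 1/(a_0 + a_1 + ... + a_n) is again a Hausdorff moment sequence, i.e. there exists a finite positive Borel measure ν on [0,1] with b_n = ∫_0^1 t^n dν(t) for all n ≥ 0. -/
open MeasureTheory

/-- `IsMonotoneOfOrder k x` says that the iterated differences `(I - E)^j x` are nonnegative for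
all `j ≤ k`, where `E` is the shift of sequences. -/
def IsMonotoneOfOrder : ℕ → (ℕ → ℝ) → Prop
  | 0, x => ∀ n, 0 ≤ x n
  | k + 1, x => (∀ n, 0 ≤ x n) ∧ IsMonotoneOfOrder k fun n => x n - x (n + 1)

namespace IsMonotoneOfOrder

lemma nonneg {k : ℕ} {x : ℕ → ℝ} (h : IsMonotoneOfOrder k x) (n : ℕ) : 0 ≤ x n := by
  cases k with
  | zero => exact h n
  | succ k => exact h.1 n

lemma of_succ {k : ℕ} {x : ℕ → ℝ} (h : IsMonotoneOfOrder (k + 1) x) : IsMonotoneOfOrder k x := by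
  induction k generalizing x with
  | zero => exact h.1
  | succ k ih => exact ⟨h.1, ih h.2⟩

lemma shift {k : ℕ} {x : ℕ → ℝ} (h : IsMonotoneOfOrder k x) :
    IsMonotoneOfOrder k fun n => x (n + 1) := by
  induction k generalizing x with
  | zero => exact fun n => h (n + 1)
  | succ k ih => exact ⟨fun n => h.1 (n + 1), ih h.2⟩

lemma add {k : ℕ} {x y : ℕ → ℝ} (hx : IsMonotoneOfOrder k x) (hy : IsMonotoneOfOrder k y) :
    IsMonotoneOfOrder k fun n => x n + y n := by
  induction k generalizing x y with
  | zero => exact fun n => add_nonneg (hx n) (hy n)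
  | succ k ih =>
    refine ⟨fun n => add_nonneg (hx.1 n) (hy.1 n), ?_⟩
    convert ih hx.2 hy.2 using 2
    ring

lemma mul {k : ℕ} {x y : ℕ → ℝ} (hx : IsMonotoneOfOrder k x) (hy : IsMonotoneOfOrder k y) :
    IsMonotoneOfOrder k fun n => x n * y n := by
  induction k generalizing x y with
  | zero => exact fun n => mul_nonneg (hx n) (hy n)
  | succ k ih =>
    refine ⟨fun n => mul_nonneg (hx.1 n) (hy.1 n), ?_⟩
    convert (ih hx.2 hy.of_succ).add (ih hx.of_succ.shift hy.2) using 2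
    ring

lemma iterate_nonneg {k : ℕ} {x : ℕ → ℝ} (h : IsMonotoneOfOrder k x) (n : ℕ) :
    0 ≤ ((fun (y : ℕ → ℝ) n => y n - y (n + 1))^[k] x) n := by
  induction k generalizing x with
  | zero => exact h n
  | succ k ih => exact ih h.2

end IsMonotoneOfOrder

lemma integrable_pow_mul_one_sub_pow {μ : Measure ℝ} [IsFiniteMeasure μ]
    (h : ∀ᵐ t ∂μ, t ∈ Set.Icc (0 : ℝ) 1) (m n : ℕ) :
    Integrable (fun t : ℝ => t ^ n * (1 - t) ^ m) μ := by
  refine Integrable.of_bound (C := 1) (by fun_prop) ?_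
  filter_upwards [h] with t ht
  have h0 : 0 ≤ 1 - t := sub_nonneg.2 ht.2
  have h1 : 0 ≤ t ^ n * (1 - t) ^ m := mul_nonneg (pow_nonneg ht.1 n) (pow_nonneg h0 m)
  rw [Real.norm_of_nonneg h1]
  exact mul_le_one₀ (pow_le_one₀ ht.1 ht.2) (pow_nonneg h0 m)
    (pow_le_one₀ h0 (by linarith [ht.1]))

lemma isMonotoneOfOrder_integral {μ : Measure ℝ} [IsFiniteMeasure μ]
    (h : ∀ᵐ t ∂μ, t ∈ Set.Icc (0 : ℝ) 1) (k m : ℕ) :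
    IsMonotoneOfOrder k fun n => ∫ t, t ^ n * (1 - t) ^ m ∂μ := by
  have key : ∀ m n, 0 ≤ ∫ t, t ^ n * (1 - t) ^ m ∂μ := fun m n => by
    refine integral_nonneg_of_ae ?_
    filter_upwards [h] with t ht
    exact mul_nonneg (pow_nonneg ht.1 n) (pow_nonneg (sub_nonneg.2 ht.2) m)
  induction k generalizing m with
  | zero => exact key m
  | succ k ih =>
    refine ⟨key m, ?_⟩
    convert ih (m + 1) using 2 with n
    rw [← integral_sub (integrable_pow_mul_one_sub_pow h m n)
      (integrable_pow_mul_one_sub_pow h m (n + 1))]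
    congr 1
    ext t
    ring

lemma isMonotoneOfOrder_inv_sum {a : ℕ → ℝ} (ha : ∀ k, IsMonotoneOfOrder k a) (h0 : 0 < a 0)
    (k : ℕ) : IsMonotoneOfOrder k fun n => (∑ i ∈ Finset.range (n + 1), a i)⁻¹ := by
  have hpos : ∀ n, 0 < ∑ i ∈ Finset.range (n + 1), a i := fun n => by
    rw [Finset.sum_range_succ']
    exact add_pos_of_nonneg_of_pos (Finset.sum_nonneg fun i _ => (ha 0).nonneg _) h0
  induction k with
  | zero => exact fun n => (inv_pos.2 (hpos n)).le
  | succ k ih =>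
    refine ⟨fun n => (inv_pos.2 (hpos n)).le, ?_⟩
    convert (ih.mul ih.shift).mul (ha k).shift using 2 with n
    have h1 := (hpos n).ne'
    have h2 := (hpos (n + 1)).ne'
    rw [inv_sub_inv h1 h2, Finset.sum_range_succ _ (n + 1), add_sub_cancel_left]
    rw [Finset.sum_range_succ _ (n + 1)] at h2
    field_simp

lemma sum_antidiagonal_choose_mul_of_pascal {c : ℕ → ℕ → ℝ}
    (hc : ∀ k n, c k n = c (k + 1) n + c k (n + 1)) (M p m : ℕ) :
    ∑ ij ∈ Finset.HasAntidiagonal.antidiagonal M, (M.choose ij.1 : ℝ) * c (p + ij.2) (m + ij.1) = c p m := by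
  induction M generalizing p m with
  | zero => simp
  | succ M ih =>
    rw [Finset.sum_antidiagonal_choose_succ_mul (fun i j => c (p + j) (m + i)) M, hc p m,
      ← ih (p + 1) m, ← ih p (m + 1)]
    congr 1
    · refine Finset.sum_congr rfl fun ij _ => ?_
      rw [add_right_comm, add_assoc]
    · refine Finset.sum_congr rfl fun ij hij => ?_
      rw [Nat.choose_symm_of_eq_add (Finset.HasAntidiagonal.mem_antidiagonal.1 hij).symm, add_right_comm m,
        add_assoc m]

lemma sum_choose_mul_descFactorial_div {c : ℕ → ℕ → ℝ}
    (hc : ∀ k n, c k n = c (k + 1) n + c k (n + 1)) {m N : ℕ} (hm : m ≤ N) :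
    ∑ k ∈ Finset.range (N + 1), (N.choose k : ℝ) * c (N - k) k *
      ((k.descFactorial m : ℝ) / N.descFactorial m) = c 0 m := by
  obtain ⟨M, rfl⟩ := Nat.exists_eq_add_of_le hm
  rw [add_assoc, Finset.sum_range_add, Finset.sum_eq_zero, zero_add,
    ← sum_antidiagonal_choose_mul_of_pascal hc M 0 m,
    Finset.Nat.sum_antidiagonal_eq_sum_range_succ_mk]
  · refine Finset.sum_congr rfl fun j _ => ?_
    have hN : ((m + M).descFactorial m : ℝ) ≠ 0 := by
      exact_mod_cast (Nat.descFactorial_pos.2 hm).ne'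
    have h : (m + M).choose (m + j) * (m + j).descFactorial m =
        (m + M).descFactorial m * M.choose j := by
      have := Nat.choose_mul (n := m + M) (k := m + j) (s := m) (by omega)
      rw [Nat.descFactorial_eq_factorial_mul_choose, Nat.descFactorial_eq_factorial_mul_choose,
        mul_left_comm, this, Nat.add_sub_cancel_left, Nat.add_sub_cancel_left, mul_assoc]
    have h' : ((m + M).choose (m + j) : ℝ) * (m + j).descFactorial m =
        (m + M).descFactorial m * M.choose j := by exact_mod_cast h
    rw [Nat.add_sub_add_left, zero_add]
    field_simp
    linear_combination c (M - j) (m + j) * h'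
  · intro k hk
    rw [Nat.descFactorial_eq_zero_iff_lt.2 (Finset.mem_range.1 hk)]
    simp

lemma abs_descFactorial_div_sub_pow_le {k N m : ℕ} (hk : k ≤ N) (hm : m ≤ N) :
    |(k.descFactorial m : ℝ) / N.descFactorial m - ((k : ℝ) / N) ^ m| ≤ (m : ℝ) ^ 2 / N := by
  induction m with
  | zero => simp
  | succ m ih =>
    have hmN : m < N := hm
    have hN : (0 : ℝ) < N := by exact_mod_cast (Nat.zero_le m).trans_lt hmN
    have hNm : (0 : ℝ) < (N : ℝ) - m := sub_pos.2 (by exact_mod_cast hmN)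
    have hkN : (k : ℝ) ≤ N := by exact_mod_cast hk
    have hk0 : (0 : ℝ) ≤ k := k.cast_nonneg
    have hm0 : (0 : ℝ) ≤ m := m.cast_nonneg
    specialize ih hmN.le
    set x : ℝ := (k : ℝ) / N
    set r : ℝ := (k.descFactorial m : ℝ) / N.descFactorial m
    set q : ℝ := ((k - m : ℕ) : ℝ) / (N - m)
    have hx0 : 0 ≤ x := by positivity
    have hx1 : x ≤ 1 := div_le_one_of_le₀ hkN hN.le
    have hq0 : 0 ≤ q := div_nonneg (Nat.cast_nonneg _) hNm.le
    have hq : q ≤ 1 ∧ |q - x| ≤ m / N := by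
      rcases le_total m k with h | h
      · have hmk : (m : ℝ) ≤ k := by exact_mod_cast h
        have hqe : q = ((k : ℝ) - m) / (N - m) := by rw [← Nat.cast_sub h]
        have hq1 : q ≤ 1 := by rw [hqe, div_le_one hNm]; linarith
        have e : q - x = -(m / N * (1 - q)) := by
          rw [hqe]; simp only [x]; field_simp; ring
        refine ⟨hq1, ?_⟩
        rw [e, abs_neg, abs_of_nonneg (mul_nonneg (by positivity) (by linarith))]
        exact mul_le_of_le_one_right (by positivity) (by linarith)
      · have hqe : q = 0 := by simp [q, Nat.sub_eq_zero_of_le h]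
        have hkm : (k : ℝ) ≤ m := by exact_mod_cast h
        rw [hqe, zero_sub, abs_neg, abs_of_nonneg hx0]
        exact ⟨zero_le_one, div_le_div_of_nonneg_right hkm hN.le⟩
    have e : (k.descFactorial (m + 1) : ℝ) / N.descFactorial (m + 1) = q * r := by
      rw [Nat.descFactorial_succ, Nat.descFactorial_succ, Nat.cast_mul, Nat.cast_mul,
        mul_div_mul_comm, Nat.cast_sub hmN.le]
    have hxm : x ^ m ≤ 1 := pow_le_one₀ hx0 hx1
    calc _ = |q * (r - x ^ m) + (q - x) * x ^ m| := by rw [e]; ring_nf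
      _ ≤ |q * (r - x ^ m)| + |(q - x) * x ^ m| := abs_add_le _ _
      _ = q * |r - x ^ m| + |q - x| * x ^ m := by
        rw [abs_mul, abs_mul, abs_of_nonneg hq0, abs_of_nonneg (pow_nonneg hx0 m)]
      _ ≤ |r - x ^ m| + |q - x| := add_le_add
        (mul_le_of_le_one_left (abs_nonneg _) hq.1) (mul_le_of_le_one_right (abs_nonneg _) hxm)
      _ ≤ (m : ℝ) ^ 2 / N + m / N := add_le_add ih hq.2
      _ ≤ ((m + 1 : ℕ) : ℝ) ^ 2 / N := by
        rw [← add_div]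
        refine div_le_div_of_nonneg_right ?_ hN.le
        push_cast
        nlinarith

open Filter Topology in
lemma tendsto_sum_choose_mul_pow {c : ℕ → ℕ → ℝ} (h0 : ∀ k n, 0 ≤ c k n)
    (hc : ∀ k n, c k n = c (k + 1) n + c k (n + 1)) (m : ℕ) :
    Tendsto (fun N : ℕ => ∑ k ∈ Finset.range (N + 1), (N.choose k : ℝ) * c (N - k) k *
      ((k : ℝ) / N) ^ m) atTop (𝓝 (c 0 m)) := by
  have hlim : Tendsto (fun N : ℕ => c 0 0 * ((m : ℝ) ^ 2 / N)) atTop (𝓝 0) := by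
    simpa using (tendsto_const_div_atTop_nhds_zero_nat ((m : ℝ) ^ 2)).const_mul (c 0 0)
  rw [tendsto_iff_dist_tendsto_zero]
  refine squeeze_zero' (Eventually.of_forall fun _ => dist_nonneg) ?_ hlim
  filter_upwards [eventually_ge_atTop m] with N hN
  rw [dist_comm, Real.dist_eq, ← sum_choose_mul_descFactorial_div hc hN,
    ← Finset.sum_sub_distrib]
  calc _ ≤ ∑ k ∈ Finset.range (N + 1), (N.choose k : ℝ) * c (N - k) k * ((m : ℝ) ^ 2 / N) := by
        refine (Finset.abs_sum_le_sum_abs _ _).trans (Finset.sum_le_sum fun k hk => ?_)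
        have hw : 0 ≤ (N.choose k : ℝ) * c (N - k) k := mul_nonneg (Nat.cast_nonneg _) (h0 _ _)
        rw [← mul_sub, abs_mul, abs_of_nonneg hw]
        exact mul_le_mul_of_nonneg_left
          (abs_descFactorial_div_sub_pow_le (Finset.mem_range_succ_iff.1 hk) hN) hw
    _ = c 0 0 * ((m : ℝ) ^ 2 / N) := by
        rw [← Finset.sum_mul]
        congr 1
        simpa using sum_choose_mul_descFactorial_div hc (Nat.zero_le N)

open Filter Topology in
/-- The Hausdorff moment theorem, for an array of iterated differences. -/
theorem exists_measure_of_pascal {c : ℕ → ℕ → ℝ} (h0 : ∀ k n, 0 ≤ c k n)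
    (hc : ∀ k n, c k n = c (k + 1) n + c k (n + 1)) :
    ∃ ν : Measure ℝ, IsFiniteMeasure ν ∧ ν (Set.Icc (0 : ℝ) 1)ᶜ = 0 ∧
      ∀ n : ℕ, c 0 n = ∫ t, t ^ n ∂ν := by
  let w : ℕ → ℕ → ℝ := fun N k => N.choose k * c (N - k) k
  have hw : ∀ N k, 0 ≤ w N k := fun N k => mul_nonneg (Nat.cast_nonneg _) (h0 _ _)
  let z : ℕ → ℕ → Set.Icc (0 : ℝ) 1 := fun N k => Set.projIcc 0 1 zero_le_one ((k : ℝ) / N)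
  let ρ : ℕ → FiniteMeasure (Set.Icc (0 : ℝ) 1) := fun N =>
    ∑ k ∈ Finset.range (N + 1), (w N k).toNNReal • ⟨Measure.dirac (z N k), inferInstance⟩
  have hint : ∀ N (f : C(Set.Icc (0 : ℝ) 1, ℝ)),
      ∫ t, f t ∂(ρ N : Measure (Set.Icc (0 : ℝ) 1)) =
        ∑ k ∈ Finset.range (N + 1), w N k * f (z N k) := by
    intro N f
    have hρ : (ρ N : Measure (Set.Icc (0 : ℝ) 1)) =
        ∑ k ∈ Finset.range (N + 1), (w N k).toNNReal • Measure.dirac (z N k) := by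
      simp only [ρ, FiniteMeasure.toMeasure_sum]
      rfl
    rw [hρ, integral_finsetSum_measure]
    · refine Finset.sum_congr rfl fun k _ => ?_
      rw [integral_smul_nnreal_measure, integral_dirac, NNReal.smul_def,
        Real.coe_toNNReal _ (hw N k), smul_eq_mul]
    · intro k _
      exact (f.continuous.integrable_of_hasCompactSupport
        (HasCompactSupport.of_compactSpace f))
  have hpow : ∀ m, Tendsto (fun N => ∫ t : Set.Icc (0 : ℝ) 1, (t : ℝ) ^ m
      ∂(ρ N : Measure (Set.Icc (0 : ℝ) 1))) atTop (𝓝 (c 0 m)) := by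
    intro m
    refine (tendsto_sum_choose_mul_pow h0 hc m).congr fun N => ?_
    refine Eq.trans ?_ (hint N ⟨fun t => (t : ℝ) ^ m, by fun_prop⟩).symm
    refine Finset.sum_congr rfl fun k hk => ?_
    have hk' : (k : ℝ) / N ∈ Set.Icc (0 : ℝ) 1 :=
      ⟨by positivity, div_le_one_of_le₀
        (by exact_mod_cast Finset.mem_range_succ_iff.1 hk) N.cast_nonneg⟩
    simp only [w, z, Set.projIcc_of_mem zero_le_one hk', ContinuousMap.coe_mk]
  have hmass : ∀ N, ρ N ∈ {μ : FiniteMeasure (Set.Icc (0 : ℝ) 1) | μ.mass ≤ (c 0 0).toNNReal} := by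
    intro N
    have h1 := hint N 1
    have h2 := sum_choose_mul_descFactorial_div hc (Nat.zero_le N)
    simp only [ContinuousMap.one_apply, integral_const, smul_eq_mul, mul_one] at h1
    simp only [Nat.descFactorial_zero, Nat.cast_one, div_one, mul_one] at h2
    rw [Set.mem_ofPred_eq, ← NNReal.coe_le_coe, Real.coe_toNNReal _ (h0 0 0), ← h2]
    exact h1.le
  obtain ⟨σ, -, hσ⟩ := (isCompact_setOfPred_finiteMeasure_le_of_compactSpace
    (Set.Icc (0 : ℝ) 1) (c 0 0).toNNReal).ultrafilter_le_nhds'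
      ((Ultrafilter.of atTop).map ρ) (Ultrafilter.mem_map.2 (Filter.univ_mem' hmass))
  have hσ' : Tendsto ρ (Ultrafilter.of atTop : Ultrafilter ℕ) (𝓝 σ) := hσ
  rw [FiniteMeasure.tendsto_iff_forall_integral_tendsto] at hσ'
  refine ⟨(σ : Measure (Set.Icc (0 : ℝ) 1)).map Subtype.val, inferInstance, ?_, fun m => ?_⟩
  · rw [Measure.map_apply measurable_subtype_coe measurableSet_Icc.compl]
    convert measure_empty (μ := (σ : Measure (Set.Icc (0 : ℝ) 1)))
    ext t
    simp
  · rw [integral_map measurable_subtype_coe.aemeasurable (by fun_prop)]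
    refine tendsto_nhds_unique ((hpow m).mono_left (Ultrafilter.of_le atTop)) ?_
    exact hσ' (BoundedContinuousFunction.mkOfCompact ⟨fun t => (t : ℝ) ^ m, by fun_prop⟩)

theorem stmt0 (μ : Measure ℝ) [IsFiniteMeasure μ]
    (hsupp : μ (Set.Icc (0:ℝ) 1)ᶜ = 0) (hμ : μ ≠ 0)
    (a : ℕ → ℝ) (ha : ∀ n : ℕ, a n = ∫ t, t ^ n ∂μ) :
    ∃ ν : Measure ℝ, IsFiniteMeasure ν ∧ ν (Set.Icc (0:ℝ) 1)ᶜ = 0 ∧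
      ∀ n : ℕ, (∑ k ∈ Finset.range (n + 1), a k)⁻¹ = ∫ t, t ^ n ∂ν := by
  have hmono : ∀ k, IsMonotoneOfOrder k a := fun k => by
    convert isMonotoneOfOrder_integral (mem_ae_iff.2 hsupp) k 0 using 2 with n
    simp [ha]
  have h0 : 0 < a 0 := by
    have : NeZero μ := ⟨hμ⟩
    rw [ha]
    simp [measureReal_def, ENNReal.toReal_pos_iff, hμ]
  let D : (ℕ → ℝ) → ℕ → ℝ := fun y n => y n - y (n + 1)
  refine exists_measure_of_pascal
    (c := fun k => D^[k] fun n => (∑ i ∈ Finset.range (n + 1), a i)⁻¹)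
    (fun k n => (isMonotoneOfOrder_inv_sum hmono h0 k).iterate_nonneg n) fun k n => ?_
  simp only [Function.iterate_succ_apply', D]
  ring
end

section
/- Let μ ≠ 0 be a finite positive Borel measure on [0,1]. Then there exists a finite positive Borel measure ν on [0,1] with ν({0}) = 0 such that for all complex z with Re z > 0 one has B(μ)(z+1) · M(ν)(z) = 1, where B(μ)(w) = ∫_0^1 (1-t^w)/(1-t) dμ(t) (with the integrand interpreted as its limit w at t = 1) and M(ν)(z) = ∫_0^1 t^z dν(z) (with t^z interpreted as 0 at t = 0). -/
open MeasureTheory unitInterval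

/-- Iterated multiplicative convolution powers of a measure on the unit interval. -/
noncomputable def convPow (τ : Measure I) : ℕ → Measure I
  | 0 => Measure.dirac 1
  | k + 1 => convPow τ k ∗ₘ τ

instance isFiniteMeasure_convPow (τ : Measure I) [IsFiniteMeasure τ] (k : ℕ) :
    IsFiniteMeasure (convPow τ k) := by
  induction k with
  | zero => rw [convPow]; infer_instance
  | succ k ih => rw [convPow]; infer_instance

theorem Continuous.integrable_of_unitInterval {f : I → ℂ} (hf : Continuous f)
    (τ : Measure I) [IsFiniteMeasure τ] : Integrable f τ :=
  BoundedContinuousFunction.integrable τ (BoundedContinuousFunction.mkOfCompact ⟨f, hf⟩)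

theorem integral_convPow (τ : Measure I) [IsFiniteMeasure τ] {f : I → ℂ} (hf : Continuous f)
    (h1 : f 1 = 1) (hmul : ∀ x y, f (x * y) = f x * f y) (k : ℕ) :
    ∫ t, f t ∂(convPow τ k) = (∫ t, f t ∂τ) ^ k := by
  induction k with
  | zero => simp [convPow, h1]
  | succ k ih =>
    rw [convPow, integral_mconv, pow_succ, ← ih]
    · simp_rw [hmul, integral_const_mul, integral_mul_const]
    · have := isFiniteMeasure_convPow τ (k + 1)
      exact hf.integrable_of_unitInterval (convPow τ (k + 1))

theorem measureReal_convPow (τ : Measure I) [IsFiniteMeasure τ] (k : ℕ) :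
    (convPow τ k).real Set.univ = τ.real Set.univ ^ k := by
  have := integral_convPow τ (f := fun _ => 1) continuous_const rfl (by simp) k
  simp only [integral_const, Complex.real_smul, mul_one] at this
  exact_mod_cast this

/-- If `τ` has total mass less than `c`, the normalised geometric series of convolution powers
of `τ / c` is a probability measure whose Mellin transform is proportional to the inverse
of `c` minus that of `τ`. -/
theorem exists_probabilityMeasure_inverse (τ : Measure I) [IsFiniteMeasure τ] {c : ℝ}
    (hc : τ.real Set.univ < c) :
    ∃ P : ProbabilityMeasure I, ∀ f : I → ℂ, Continuous f → f 1 = 1 →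
      (∀ x y, f (x * y) = f x * f y) → (∀ x, ‖f x‖ ≤ 1) →
      ((c : ℂ) - ∫ t, f t ∂τ) * ∫ t, f t ∂(P : Measure I) = c - τ.real Set.univ := by
  set m := τ.real Set.univ with hm
  have hm0 : 0 ≤ m := measureReal_nonneg
  have hc0 : 0 < c := hm0.trans_lt hc
  have hcm : 0 < c - m := sub_pos.2 hc
  have hsum : HasSum (fun k : ℕ => (c - m) / c * (m / c) ^ k) 1 := by
    have := (hasSum_geometric_of_lt_one (div_nonneg hm0 hc0.le) ((div_lt_one hc0).2 hc)).mul_left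
      ((c - m) / c)
    rwa [one_sub_div hc0.ne', inv_div, div_mul_div_cancel₀ hc0.ne', div_self hcm.ne'] at this
  set w : ℕ → NNReal := fun k => Real.toNNReal ((c - m) / c * (1 / c) ^ k) with hw
  have hwr (k) : (w k : ℝ) = (c - m) / c * (1 / c) ^ k := Real.coe_toNNReal _ (by positivity)
  set ν : Measure I := Measure.sum fun k => w k • convPow τ k with hν
  have hprob : IsProbabilityMeasure ν := by
    constructor
    rw [hν, Measure.sum_apply _ MeasurableSet.univ]
    have h (k) : (w k • convPow τ k) Set.univ
        = ENNReal.ofReal ((c - m) / c * (m / c) ^ k) := by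
      rw [← ENNReal.ofReal_toReal (measure_ne_top (w k • convPow τ k) Set.univ)]
      congr 1
      rw [← measureReal_def, measureReal_nnreal_smul_apply, measureReal_convPow, hwr, ← hm]
      simp only [div_pow, one_pow]
      ring
    simp_rw [h]
    rw [← ENNReal.ofReal_tsum_of_nonneg (fun k => by positivity) hsum.summable, hsum.tsum_eq,
      ENNReal.ofReal_one]
  refine ⟨⟨ν, hprob⟩, fun f hf h1 hmul hb => ?_⟩
  have hI : Integrable f (Measure.sum fun k => w k • convPow τ k) :=
    hf.integrable_of_unitInterval ν
  have hs := hasSum_integral_measure hI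
  have hx : ‖∫ t, f t ∂τ‖ ≤ m := by
    simpa using norm_integral_le_of_norm_le_const (μ := τ) (Filter.Eventually.of_forall hb)
  set x := ∫ t, f t ∂τ with hxdef
  have hcC : (c : ℂ) ≠ 0 := by exact_mod_cast hc0.ne'
  have hterm (k) : ∫ t, f t ∂(w k • convPow τ k) = ((c - m) / c : ℂ) * (x / c) ^ k := by
    rw [integral_smul_nnreal_measure, integral_convPow τ hf h1 hmul, NNReal.smul_def, hwr, ← hxdef,
      Complex.real_smul]
    push_cast
    simp only [div_pow, one_pow]
    ring
  simp_rw [hterm] at hs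
  have hlt : ‖x / c‖ < 1 := by
    rw [norm_div, Complex.norm_real, Real.norm_of_nonneg hc0.le, div_lt_one hc0]
    exact hx.trans_lt hc
  have hs2 := (hasSum_geometric_of_norm_lt_one hlt).mul_left ((c - m) / c : ℂ)
  have hne : (c : ℂ) - x ≠ 0 := by
    intro h
    have : ‖x‖ = c := by
      rw [← sub_eq_zero.1 h, Complex.norm_real, Real.norm_of_nonneg hc0.le]
    linarith
  change (c - x) * ∫ t, f t ∂ν = _
  rw [hν, hs.unique hs2]
  have : (1 : ℂ) - x / c = (c - x) / c := by field_simp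
  rw [this]
  field_simp

theorem continuous_unitInterval_cpow {z : ℂ} (hz : 0 < z.re) :
    Continuous fun t : I => ((t : ℝ) : ℂ) ^ z :=
  (Complex.continuous_ofReal_cpow_const hz).comp continuous_subtype_val

theorem norm_unitInterval_cpow_le_one {z : ℂ} (hz : 0 < z.re) (t : I) :
    ‖((t : ℝ) : ℂ) ^ z‖ ≤ 1 := by
  rw [Complex.norm_cpow_eq_rpow_re_of_nonneg t.2.1 hz.ne']
  exact Real.rpow_le_one t.2.1 t.2.2 hz.le

theorem exists_probabilityMeasure_truncated (μ : Measure I) [IsFiniteMeasure μ] (hμ : μ ≠ 0)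
    {a : I} (ha : (a : ℝ) < 1) :
    ∃ P : ProbabilityMeasure I, ∀ z : ℂ, 0 < z.re →
      (∫ t : I, (1 - ((min t a : I) : ℂ) ^ (z + 1)) / (1 - ((min t a : I) : ℂ)) ∂μ) *
        ∫ t : I, ((t : ℝ) : ℂ) ^ z ∂(P : Measure I) = μ.real Set.univ := by
  have hρc : Continuous fun t : I => min t a := by fun_prop
  have hρ (t : I) : 0 < 1 - ((min t a : I) : ℝ) :=
    sub_pos.2 (lt_of_le_of_lt (Subtype.coe_le_coe.2 (min_le_right t a)) ha)
  set g : I → ℝ := fun t => (min t a : I) / (1 - (min t a : I)) with hg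
  have hgc : Continuous g := by
    apply Continuous.div (by fun_prop) (by fun_prop) fun t => (hρ t).ne'
  have hg0 (t) : 0 ≤ g t := div_nonneg (min t a).2.1 (hρ t).le
  have hgi : Integrable g μ :=
    BoundedContinuousFunction.integrable μ (BoundedContinuousFunction.mkOfCompact ⟨g, hgc⟩)
  set κ := μ.withDensity fun t => ENNReal.ofReal (g t) with hκ
  have : IsFiniteMeasure κ := isFiniteMeasure_withDensity_ofReal hgi.2
  set τ := κ.map fun t : I => min t a with hτ
  have hint (f : I → ℂ) (hf : Continuous f) : ∫ t, f t ∂τ = ∫ t, (g t : ℂ) * f (min t a) ∂μ := by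
    rw [hτ, integral_map hρc.aemeasurable hf.aestronglyMeasurable, hκ,
      integral_withDensity_eq_integral_toReal_smul (by fun_prop) (by simp)]
    simp [ENNReal.toReal_ofReal (hg0 _)]
  set h : I → ℂ := fun t => ((1 - (min t a : I) : ℝ) : ℂ)⁻¹ with hh
  have hne (t : I) : (1 - ((min t a : I) : ℝ) : ℂ) ≠ 0 := by exact_mod_cast (hρ t).ne'
  have hhc : Continuous h := by
    apply Continuous.inv₀ (by fun_prop) fun t => by exact_mod_cast hne t
  set c : ℝ := ∫ t, (1 - (min t a : I) : ℝ)⁻¹ ∂μ with hc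
  have hcC : (c : ℂ) = ∫ t, h t ∂μ := by
    rw [hc, ← integral_complex_ofReal]; simp [hh]
  have key (f : I → ℂ) (hf : Continuous f) :
      (c : ℂ) - ∫ t, f t ∂τ = ∫ t, (1 - (min t a : I) * f (min t a)) / (1 - (min t a : I)) ∂μ := by
    rw [hcC, hint f hf, ← integral_sub (hhc.integrable_of_unitInterval μ)]
    · congr 1 with t
      simp only [hh, hg]
      push_cast
      have := hne t
      field_simp
    · apply Continuous.integrable_of_unitInterval
      exact (Complex.continuous_ofReal.comp hgc).mul (hf.comp hρc)
  have hmass : c - τ.real Set.univ = μ.real Set.univ := by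
    have h1 := key (fun _ => 1) continuous_const
    simp only [mul_one] at h1
    simp_rw [div_self (hne _)] at h1
    simp only [integral_const, Complex.real_smul, mul_one] at h1
    exact_mod_cast h1
  have hpos : 0 < μ.real Set.univ := by
    have : NeZero μ := ⟨hμ⟩
    exact measureReal_univ_pos
  obtain ⟨P, hP⟩ := exists_probabilityMeasure_inverse τ (c := c) (by linarith)
  refine ⟨P, fun z hz => ?_⟩
  have := hP (fun t => ((t : ℝ) : ℂ) ^ z) (continuous_unitInterval_cpow hz) (by simp)
    (fun x y => by
      simpa using Complex.mul_cpow_ofReal_nonneg x.2.1 y.2.1 z)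
    (norm_unitInterval_cpow_le_one hz)
  rw [key _ (continuous_unitInterval_cpow hz)] at this
  have hpow (t : I) : ((min t a : I) : ℂ) ^ (z + 1) =
      (min t a : I) * ((min t a : I) : ℂ) ^ z := by
    by_cases h0 : (((min t a : I) : ℝ) : ℂ) = 0
    · rw [h0, Complex.zero_cpow, zero_mul]
      intro h
      have := congrArg Complex.re h
      simp at this
      linarith
    · rw [Complex.cpow_add _ _ h0, Complex.cpow_one, mul_comm]
  simp_rw [hpow]
  rw [this, ← hmass, Complex.ofReal_sub]

theorem hasDerivAt_ofReal_cpow_of_pos (w : ℂ) {x : ℝ} (hx : 0 < x) :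
    HasDerivAt (fun s : ℝ => (s : ℂ) ^ w) (w * (x : ℂ) ^ (w - 1)) x := by
  have := (hasDerivAt_id (x : ℂ)).cpow_const (c := w) (Or.inl (by simpa using hx))
  simpa using this.comp_ofReal

theorem norm_one_sub_cpow_le {w : ℂ} (hw : 1 < w.re) {t : ℝ} (h0 : 0 ≤ t) (h1 : t ≤ 1) :
    ‖1 - (t : ℂ) ^ w‖ ≤ ‖w‖ * (1 - t) := by
  rcases h0.eq_or_lt with rfl | h0
  · have : w ≠ 0 := by rintro rfl; simp at hw; linarith
    simpa [Complex.zero_cpow this] using hw.le.trans (Complex.re_le_norm w)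
  · have := norm_image_sub_le_of_norm_deriv_le_segment' (a := t) (b := 1)
      (f := fun s : ℝ => (s : ℂ) ^ w) (C := ‖w‖)
      (fun x hx => (hasDerivAt_ofReal_cpow_of_pos w (h0.trans_le hx.1)).hasDerivWithinAt)
      (fun x hx => by
        rw [norm_mul]
        refine mul_le_of_le_one_right (norm_nonneg _) ?_
        rw [Complex.norm_cpow_eq_rpow_re_of_pos (h0.trans_le hx.1)]
        refine Real.rpow_le_one (h0.le.trans hx.1) hx.2.le ?_
        simpa using hw.le) 1 (Set.right_mem_Icc.2 h1)
    simpa using this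

theorem norm_one_sub_cpow_div_le {w : ℂ} (hw : 1 < w.re) {t : ℝ} (h0 : 0 ≤ t) (h1 : t ≤ 1) :
    ‖(1 - (t : ℂ) ^ w) / (1 - (t : ℂ))‖ ≤ ‖w‖ := by
  rw [norm_div, ← Complex.ofReal_one, ← Complex.ofReal_sub, Complex.norm_real,
    Real.norm_of_nonneg (sub_nonneg.2 h1)]
  exact div_le_of_le_mul₀ (sub_nonneg.2 h1) (norm_nonneg _)
    (by simpa using norm_one_sub_cpow_le hw h0 h1)

theorem tendsto_one_sub_cpow_div (w : ℂ) :
    Filter.Tendsto (fun s : ℝ => (1 - (s : ℂ) ^ w) / (1 - (s : ℂ))) (nhdsWithin 1 {1}ᶜ)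
      (nhds w) := by
  have := (hasDerivAt_ofReal_cpow_of_pos w one_pos).tendsto_slope
  simp only [Complex.ofReal_one, Complex.one_cpow, mul_one] at this
  refine this.congr fun s => ?_
  rw [slope_def_module, Complex.real_smul]
  simp only [Complex.ofReal_one, Complex.one_cpow]
  rw [← neg_div_neg_eq, div_eq_inv_mul]
  push_cast
  ring_nf

theorem exists_probabilityMeasure_bernstein_mul_mellin (μ : Measure I) [IsFiniteMeasure μ]
    (hμ : μ ≠ 0) :
    ∃ P : ProbabilityMeasure I, ∀ z : ℂ, 0 < z.re →
      (∫ t : I, (if (t : ℝ) = 1 then z + 1 else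
        (1 - ((t : ℝ) : ℂ) ^ (z + 1)) / (1 - ((t : ℝ) : ℂ))) ∂μ) *
        ∫ t : I, ((t : ℝ) : ℂ) ^ z ∂(P : Measure I) = μ.real Set.univ := by
  let a : ℕ → I := fun n => ⟨1 - 1 / ((n : ℝ) + 1), by
    have : (0 : ℝ) < n + 1 := by positivity
    constructor
    · rw [sub_nonneg, div_le_one this]; linarith [(Nat.cast_nonneg n : (0 : ℝ) ≤ n)]
    · have := one_div_pos.2 this
      linarith⟩
  have ha (n) : (a n : ℝ) < 1 := by
    have : (0 : ℝ) < 1 / ((n : ℝ) + 1) := by positivity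
    change 1 - 1 / ((n : ℝ) + 1) < 1
    linarith
  have hat : Filter.Tendsto (fun n => (a n : ℝ)) Filter.atTop (nhds 1) := by
    simpa [a] using (tendsto_const_nhds (x := (1 : ℝ))).sub
      (tendsto_one_div_add_atTop_nhds_zero_nat (𝕜 := ℝ))
  choose P hP using fun n => exists_probabilityMeasure_truncated μ hμ (ha n)
  obtain ⟨Q, -, hQ⟩ := isCompact_univ.ultrafilter_le_nhds
    ((Filter.hyperfilter ℕ).map P) (by simp)
  refine ⟨Q, fun z hz => ?_⟩
  have hM : Filter.Tendsto (fun n => ∫ t : I, ((t : ℝ) : ℂ) ^ z ∂(P n : Measure I))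
      (Filter.hyperfilter ℕ) (nhds (∫ t : I, ((t : ℝ) : ℂ) ^ z ∂(Q : Measure I))) :=
    (ProbabilityMeasure.tendsto_iff_forall_integral_rclike_tendsto ℂ).1
      (show Filter.Tendsto P (Filter.hyperfilter ℕ) (nhds Q) from hQ)
      (BoundedContinuousFunction.mkOfCompact ⟨_, continuous_unitInterval_cpow hz⟩)
  have hw : 1 < (z + 1).re := by simpa using hz
  have hB : Filter.Tendsto (fun n => ∫ t : I, (1 - ((min t (a n) : I) : ℂ) ^ (z + 1)) /
      (1 - ((min t (a n) : I) : ℂ)) ∂μ) Filter.atTop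
      (nhds (∫ t : I, (if (t : ℝ) = 1 then z + 1 else
        (1 - ((t : ℝ) : ℂ) ^ (z + 1)) / (1 - ((t : ℝ) : ℂ))) ∂μ)) := by
    refine tendsto_integral_of_dominated_convergence (fun _ => ‖z + 1‖) (fun n => ?_)
      (integrable_const _) (fun n => Filter.Eventually.of_forall fun t =>
        norm_one_sub_cpow_div_le hw (min t (a n)).2.1 (min t (a n)).2.2)
      (Filter.Eventually.of_forall fun t => ?_)
    · apply Measurable.aestronglyMeasurable
      have : Measurable fun t : I => ((min t (a n) : I) : ℝ) := by fun_prop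
      fun_prop
    · by_cases ht : (t : ℝ) = 1
      · have ht' : t = 1 := Subtype.ext ht
        subst ht'
        have hmin (n) : min 1 (a n) = a n := min_eq_right (a n).2.2
        simp only [hmin, Set.Icc.coe_one, if_true]
        exact (tendsto_one_sub_cpow_div (z + 1)).comp
          (tendsto_nhdsWithin_iff.2 ⟨hat, Filter.Eventually.of_forall fun n => (ha n).ne⟩)
      · rw [if_neg ht]
        refine tendsto_const_nhds.congr' ?_
        have : (t : ℝ) < 1 := lt_of_le_of_ne t.2.2 ht
        filter_upwards [hat.eventually (lt_mem_nhds this)] with n hn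
        rw [min_eq_left (show t ≤ a n from Subtype.coe_le_coe.1 hn.le)]
  have hlim := (hB.mono_left Nat.hyperfilter_le_atTop).mul hM
  simp_rw [fun n => hP n z hz] at hlim
  exact tendsto_nhds_unique hlim tendsto_const_nhds

theorem stmt1 (μ : Measure ℝ) [IsFiniteMeasure μ]
    (hsupp : μ (Set.Icc (0:ℝ) 1)ᶜ = 0) (hμ : μ ≠ 0) :
    ∃ ν : Measure ℝ, IsFiniteMeasure ν ∧ ν (Set.Icc (0:ℝ) 1)ᶜ = 0 ∧ ν {0} = 0 ∧
      ∀ z : ℂ, 0 < z.re →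
        (∫ t : ℝ, (if t = 1 then z + 1 else (1 - (t : ℂ) ^ (z + 1)) / (1 - (t : ℂ))) ∂μ) *
          (∫ t : ℝ, (t : ℂ) ^ z ∂ν) = 1 := by
  have hres : μ.restrict (Set.Icc (0 : ℝ) 1) = μ :=
    Measure.restrict_eq_self_of_ae_mem (mem_ae_iff.2 hsupp)
  set μ' : Measure I := μ.comap Subtype.val with hμ'
  have hmap : μ'.map Subtype.val = μ := by
    rw [hμ', (MeasurableEmbedding.subtype_coe measurableSet_Icc).map_comap, Subtype.range_coe]
    exact hres
  have hfin : IsFiniteMeasure μ' := by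
    constructor
    rw [← Set.preimage_univ (f := (Subtype.val : I → ℝ)),
      ← Measure.map_apply measurable_subtype_coe MeasurableSet.univ, hmap]
    exact measure_lt_top _ _
  have hne : μ' ≠ 0 := by
    intro h
    rw [h, Measure.map_zero] at hmap
    exact hμ hmap.symm
  have hpos : 0 < μ'.real Set.univ := by
    have : NeZero μ' := ⟨hne⟩
    exact measureReal_univ_pos
  obtain ⟨P, hP⟩ := exists_probabilityMeasure_bernstein_mul_mellin μ' hne
  set M : NNReal := (μ'.real Set.univ)⁻¹.toNNReal with hM
  have hMr : (M : ℝ) = (μ'.real Set.univ)⁻¹ := Real.coe_toNNReal _ (by positivity)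
  set N : Measure ℝ := (P : Measure I).map Subtype.val with hN
  have hemb : MeasurableEmbedding (Subtype.val : I → ℝ) :=
    MeasurableEmbedding.subtype_coe measurableSet_Icc
  have : IsFiniteMeasure N := by rw [hN]; infer_instance
  refine ⟨M • N.restrict {0}ᶜ, inferInstance, ?_, ?_, fun z hz => ?_⟩
  · have h : N (Set.Icc (0 : ℝ) 1)ᶜ = 0 := by
      rw [hN, hemb.map_apply]
      simp
    have h2 : N.restrict {0}ᶜ (Set.Icc (0 : ℝ) 1)ᶜ = 0 :=
      le_antisymm ((Measure.restrict_apply_le _ _).trans h.le) bot_le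
    simp [h2]
  · simp [Measure.restrict_apply]
  · have hz0 : z ≠ 0 := by rintro rfl; simp at hz
    have h1 : ∫ t in {0}ᶜ, (t : ℂ) ^ z ∂N = ∫ t, (t : ℂ) ^ z ∂N :=
      setIntegral_eq_integral_of_forall_compl_eq_zero fun t ht => by
        have : t = 0 := by simpa using ht
        simp [this, hz0]
    rw [integral_smul_nnreal_measure, h1, hN, hemb.integral_map]
    conv_lhs => rw [← hmap, hemb.integral_map]
    rw [NNReal.smul_def, hMr, mul_smul_comm, hP z hz, Complex.real_smul]
    exact_mod_cast inv_mul_cancel₀ hpos.ne'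
end

section
/- There exists a unique sequence (m_n)_{n≥0} of real numbers in [0,1] with m_0 = 1 satisfying (m_0 + m_1 + ... + m_n) · m_n = 1 for all n ≥ 1. -/
/-- The nonnegative root `x` of `(s + x) * x = 1`. -/
noncomputable def increment (s : ℝ) : ℝ := (√(s ^ 2 + 4) - s) / 2

/-- The partial sums of the sequence whose terms after the first are given by `increment`. -/
noncomputable def partialSum : ℕ → ℝ
  | 0 => 1
  | n + 1 => partialSum n + increment (partialSum n)

theorem add_increment_mul_increment (s : ℝ) : (s + increment s) * increment s = 1 := by
  have h : √(s ^ 2 + 4) ^ 2 = s ^ 2 + 4 := Real.sq_sqrt (by positivity)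
  unfold increment
  linear_combination h / 4

theorem increment_mem_Icc {s : ℝ} (hs : 0 ≤ s) : increment s ∈ Set.Icc (0 : ℝ) 1 := by
  have h₁ : s ≤ √(s ^ 2 + 4) := Real.le_sqrt_of_sq_le (by linarith)
  have h₂ : √(s ^ 2 + 4) ≤ s + 2 := Real.sqrt_le_iff.2 ⟨by linarith, by nlinarith⟩
  unfold increment
  constructor <;> linarith

theorem partialSum_nonneg (n : ℕ) : 0 ≤ partialSum n := by
  induction n with
  | zero => simp [partialSum]
  | succ n ih => exact add_nonneg ih (increment_mem_Icc ih).1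

theorem eq_of_add_mul_self_eq_one {s a b : ℝ} (hs : 0 < s) (ha : 0 ≤ a) (hb : 0 ≤ b)
    (h₁ : (s + a) * a = 1) (h₂ : (s + b) * b = 1) : a = b := by
  have h : (a - b) * (s + a + b) = 0 := by linear_combination h₁ - h₂
  rcases mul_eq_zero.1 h with h | h <;> linarith

theorem stmt2 :
    ∃! m : ℕ → ℝ, (∀ n : ℕ, m n ∈ Set.Icc (0:ℝ) 1) ∧ m 0 = 1 ∧
      ∀ n : ℕ, 1 ≤ n → (∑ k ∈ Finset.range (n + 1), m k) * m n = 1 := by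
  refine existsUnique_of_exists_of_unique ?_ ?_
  · let m : ℕ → ℝ := fun n => Nat.casesOn n 1 fun k => increment (partialSum k)
    have hsum (n : ℕ) : ∑ k ∈ Finset.range (n + 1), m k = partialSum n := by
      induction n with
      | zero => simp [m, partialSum]
      | succ n ih => rw [Finset.sum_range_succ, ih]; rfl
    refine ⟨m, ?_, rfl, ?_⟩
    · rintro (_ | n)
      · simp [m]
      · exact increment_mem_Icc (partialSum_nonneg n)
    · rintro (_ | n) hn
      · omega
      · rw [hsum]
        exact add_increment_mul_increment (partialSum n)
  · rintro a b ⟨ha, ha₀, ha₁⟩ ⟨hb, hb₀, hb₁⟩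
    funext n
    induction n using Nat.strong_induction_on with
    | _ n ih =>
      rcases n with _ | n
      · rw [ha₀, hb₀]
      · have hs : 0 < ∑ k ∈ Finset.range (n + 1), a k :=
          Finset.sum_pos' (fun k _ => (ha k).1) ⟨0, by simp, by simp [ha₀]⟩
        have hab : ∑ k ∈ Finset.range (n + 1), a k = ∑ k ∈ Finset.range (n + 1), b k :=
          Finset.sum_congr rfl fun k hk => ih k (Finset.mem_range.1 hk)
        have h₁ := ha₁ (n + 1) (by omega)
        have h₂ := hb₁ (n + 1) (by omega)
        rw [Finset.sum_range_succ] at h₁ h₂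
        rw [← hab] at h₂
        exact eq_of_add_mul_self_eq_one hs (ha _).1 (hb _).1 h₁ h₂
end

section
/- Let (m_n)_{n≥0} be the sequence in [0,1] with m_0 = 1 satisfying (m_0 + m_1 + ... + m_n) · m_n = 1 for all n ≥ 1. Then m_{n+1}^2 + m_{n+1}/m_n − 1 = 0 for all n ≥ 1, and m_1 = (−1 + √5)/2 and m_2 = (√(22 + 2√5) − √5 − 1)/4. -/
/-- The nonnegative root of a monic quadratic `x ^ 2 + b * x = 1`. -/
theorem eq_of_add_mul_self_eq_one_s3 {b x : ℝ} (hb : 0 ≤ b) (hx : 0 ≤ x) (h : (b + x) * x = 1) :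
    x = (Real.sqrt (b ^ 2 + 4) - b) / 2 := by
  have : Real.sqrt (b ^ 2 + 4) = 2 * x + b := by
    rw [← Real.sqrt_sq (by positivity : 0 ≤ 2 * x + b)]
    congr 1
    linear_combination -4 * h
  rw [this]
  ring

theorem stmt3 (m : ℕ → ℝ) (hmem : ∀ n : ℕ, m n ∈ Set.Icc (0:ℝ) 1) (h0 : m 0 = 1)
    (hfix : ∀ n : ℕ, 1 ≤ n → (∑ k ∈ Finset.range (n + 1), m k) * m n = 1) :
    (∀ n : ℕ, 1 ≤ n → m (n + 1) ^ 2 + m (n + 1) / m n - 1 = 0) ∧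
      m 1 = (-1 + Real.sqrt 5) / 2 ∧
      m 2 = (Real.sqrt (22 + 2 * Real.sqrt 5) - Real.sqrt 5 - 1) / 4 := by
  have h1 : m 1 = (-1 + Real.sqrt 5) / 2 := by
    have h := hfix 1 le_rfl
    simp only [Finset.sum_range_succ, Finset.sum_range_zero, h0, zero_add] at h
    rw [eq_of_add_mul_self_eq_one_s3 zero_le_one (hmem 1).1 h]
    norm_num
    ring
  refine ⟨fun n hn => ?_, h1, ?_⟩
  · have h := hfix n hn
    have h' := hfix (n + 1) (by omega)
    rw [Finset.sum_range_succ] at h'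
    rw [div_eq_mul_inv, ← eq_inv_of_mul_eq_one_left h]
    linear_combination h'
  · have h := hfix 2 (by norm_num)
    simp only [Finset.sum_range_succ, Finset.sum_range_zero, h0, zero_add] at h
    have h5 : Real.sqrt 5 ^ 2 = 5 := Real.sq_sqrt (by norm_num)
    have hs : 22 + 2 * Real.sqrt 5 = 2 ^ 2 * ((1 + m 1) ^ 2 + 4) := by
      rw [h1]
      linear_combination -h5
    rw [eq_of_add_mul_self_eq_one_s3 (add_nonneg zero_le_one (hmem 1).1) (hmem 2).1 h, hs,
      Real.sqrt_mul (by norm_num), Real.sqrt_sq (by norm_num)]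
    linear_combination -h1 / 2
end

section
/- Fix 0 < q < 1 and define f_q(z) = (1-q)(z + ∑_{k=1}^∞ q^k (1-q^{kz})/(1-q^k)) for Re z > 0, the q-digamma function ψ_q(z) = −log(1-q) + log q · ∑_{k=0}^∞ q^{k+z}/(1-q^{k+z}), and γ_q = −ψ_q(1). Then for all z with Re z > 0, f_q(z)/(1-q) = z + (γ_q + ψ_q(z+1))/log(1/q). -/
/-- The Bernstein transform of the Jackson measure `d_q t`. -/
noncomputable def fq (q : ℝ) (z : ℂ) : ℂ :=
  (1 - q) * (z + ∑' k : ℕ,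
    (q : ℂ) ^ (k + 1) * (1 - (q : ℂ) ^ (((k : ℂ) + 1) * z)) / (1 - (q : ℂ) ^ (k + 1)))

/-- The `q`-digamma function `ψ_q`. -/
noncomputable def psiq (q : ℝ) (z : ℂ) : ℂ :=
  -(Real.log (1 - q) : ℂ) + (Real.log q : ℂ) *
    ∑' k : ℕ, (q : ℂ) ^ ((k : ℂ) + z) / (1 - (q : ℂ) ^ ((k : ℂ) + z))

/-- The double family `(x Q ^ (j + 1)) ^ (k + 1)` underlying a Lambert series is summable. -/
theorem summable_lambert_double {Q x : ℂ} (hQ : ‖Q‖ < 1) (hx : ‖x‖ ≤ 1) :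
    Summable fun p : ℕ × ℕ => (x * Q ^ (p.2 + 1)) ^ (p.1 + 1) := by
  have hg := summable_geometric_of_lt_one (norm_nonneg Q) hQ
  refine Summable.of_norm_bounded (hg.mul_of_nonneg hg (fun _ => by positivity)
    (fun _ => by positivity)) fun p => ?_
  rw [mul_pow, norm_mul, norm_pow, ← pow_mul, norm_pow, ← pow_add]
  calc ‖x‖ ^ (p.1 + 1) * ‖Q‖ ^ ((p.2 + 1) * (p.1 + 1))
      ≤ 1 * ‖Q‖ ^ ((p.2 + 1) * (p.1 + 1)) := by
        gcongr
        exact pow_le_one₀ (norm_nonneg x) hx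
    _ ≤ ‖Q‖ ^ (p.1 + p.2) := by
        rw [one_mul]
        exact pow_le_pow_of_le_one (norm_nonneg Q) hQ.le (by nlinarith)

theorem hasSum_pow_succ {w : ℂ} (hw : ‖w‖ < 1) :
    HasSum (fun k : ℕ => w ^ (k + 1)) (w / (1 - w)) := by
  simpa only [pow_succ', div_eq_mul_inv] using (hasSum_geometric_of_norm_lt_one hw).mul_left w

theorem norm_mul_pow_succ_lt_one {Q x : ℂ} (hQ : ‖Q‖ < 1) (hx : ‖x‖ ≤ 1) (j : ℕ) :
    ‖x * Q ^ (j + 1)‖ < 1 := by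
  rw [norm_mul, norm_pow]
  exact (mul_le_of_le_one_left (by positivity) hx).trans_lt
    (pow_lt_one₀ (norm_nonneg Q) hQ j.succ_ne_zero)

theorem hasSum_lambert_row {Q x : ℂ} (hQ : ‖Q‖ < 1) (k : ℕ) :
    HasSum (fun j : ℕ => (x * Q ^ (j + 1)) ^ (k + 1))
      (x ^ (k + 1) * (Q ^ (k + 1) / (1 - Q ^ (k + 1)))) := by
  have hw : ‖Q ^ (k + 1)‖ < 1 := by
    rw [norm_pow]
    exact pow_lt_one₀ (norm_nonneg Q) hQ k.succ_ne_zero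
  simpa only [mul_pow, pow_right_comm Q _ (k + 1)] using
    (hasSum_pow_succ hw).mul_left (x ^ (k + 1))

/-- Interchanging the order of summation in a Lambert series. -/
theorem hasSum_lambert {Q x : ℂ} (hQ : ‖Q‖ < 1) (hx : ‖x‖ ≤ 1) :
    HasSum (fun k : ℕ => x ^ (k + 1) * (Q ^ (k + 1) / (1 - Q ^ (k + 1))))
      (∑' j : ℕ, x * Q ^ (j + 1) / (1 - x * Q ^ (j + 1))) := by
  obtain ⟨S, hS⟩ := summable_lambert_double hQ hx
  have hswap : HasSum (fun p : ℕ × ℕ => (x * Q ^ (p.1 + 1)) ^ (p.2 + 1)) S :=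
    (Equiv.prodComm ℕ ℕ).hasSum_iff.mpr hS
  have hfiber (j : ℕ) : HasSum (fun k : ℕ => (x * Q ^ (j + 1)) ^ (k + 1))
      (x * Q ^ (j + 1) / (1 - x * Q ^ (j + 1))) :=
    hasSum_pow_succ (norm_mul_pow_succ_lt_one hQ hx j)
  have hrow := hswap.prod_fiberwise hfiber
  rw [hrow.tsum_eq]
  exact hS.prod_fiberwise fun k => hasSum_lambert_row hQ k

theorem psiq_add_one (q : ℝ) (hq0 : 0 < q) (z : ℂ) :
    psiq q (z + 1) = -(Real.log (1 - q) : ℂ) + (Real.log q : ℂ) *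
      ∑' j : ℕ, (q : ℂ) ^ z * (q : ℂ) ^ (j + 1) / (1 - (q : ℂ) ^ z * (q : ℂ) ^ (j + 1)) := by
  have hq : (q : ℂ) ≠ 0 := by exact_mod_cast hq0.ne'
  have hterm (j : ℕ) : (q : ℂ) ^ ((j : ℂ) + (z + 1)) = (q : ℂ) ^ z * (q : ℂ) ^ (j + 1) := by
    rw [← Complex.cpow_natCast, ← Complex.cpow_add _ _ hq]
    push_cast
    ring_nf
  simp only [psiq, hterm]

theorem stmt6 (q : ℝ) (hq0 : 0 < q) (hq1 : q < 1) (z : ℂ) (hz : 0 < z.re) :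
    fq q z / (1 - q) = z + (-psiq q 1 + psiq q (z + 1)) / (Real.log (1 / q) : ℂ) := by
  have hQ : ‖(q : ℂ)‖ < 1 := by
    rwa [Complex.norm_real, Real.norm_of_nonneg hq0.le]
  have hx : ‖(q : ℂ) ^ z‖ ≤ 1 := by
    rw [Complex.norm_cpow_eq_rpow_re_of_pos hq0]
    exact Real.rpow_le_one hq0.le hq1.le hz.le
  have hq1' : (1 : ℂ) - q ≠ 0 := by exact_mod_cast (sub_pos.mpr hq1).ne'
  have hlog : (Real.log q : ℂ) ≠ 0 := by exact_mod_cast (Real.log_neg hq0 hq1).ne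
  have hone := psiq_add_one q hq0 0
  rw [zero_add, Complex.cpow_zero] at hone
  have hterm (k : ℕ) :
      (q : ℂ) ^ (k + 1) * (1 - (q : ℂ) ^ (((k : ℂ) + 1) * z)) / (1 - (q : ℂ) ^ (k + 1)) =
        1 ^ (k + 1) * ((q : ℂ) ^ (k + 1) / (1 - (q : ℂ) ^ (k + 1))) -
          ((q : ℂ) ^ z) ^ (k + 1) * ((q : ℂ) ^ (k + 1) / (1 - (q : ℂ) ^ (k + 1))) := by
    have hpow : (q : ℂ) ^ (((k : ℂ) + 1) * z) = ((q : ℂ) ^ z) ^ (k + 1) := by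
      rw [← Complex.cpow_nat_mul]
      push_cast
      rfl
    rw [hpow]
    ring
  rw [fq, mul_div_cancel_left₀ _ hq1', psiq_add_one q hq0, hone, tsum_congr hterm,
    ((hasSum_lambert hQ norm_one.le).sub (hasSum_lambert hQ hx)).tsum_eq,
    one_div, Real.log_inv, Complex.ofReal_neg]
  field_simp
  ring
end

section
/- For 0 < q < 1, ∑_{k=1}^∞ q^k/(1-q^k) = ∑_{n=1}^∞ (1 − ∏_{j=0}^∞ (1 − q^{n+j})), where both series converge. -/
/-- The Lambert series `∑ q ^ k / (1 - q ^ k)` converges for `0 < q < 1`. -/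
theorem summable_pow_div_one_sub_pow {q : ℝ} (hq0 : 0 < q) (hq1 : q < 1) :
    Summable (fun k : ℕ => q ^ (k + 1) / (1 - q ^ (k + 1))) := by
  have hle (k : ℕ) : q ^ (k + 1) ≤ q := pow_le_of_le_one hq0.le hq1.le k.succ_ne_zero
  refine Summable.of_nonneg_of_le
    (fun k => div_nonneg (by positivity) (by linarith [hle k])) (fun k => ?_)
    (((summable_nat_add_iff 1).2 (summable_geometric_of_lt_one hq0.le hq1)).div_const (1 - q))
  exact div_le_div_of_nonneg_left (by positivity) (by linarith) (by linarith [hle k])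

theorem prod_one_sub_pow_mem_Icc {q : ℝ} (hq0 : 0 < q) (hq1 : q < 1) (n N : ℕ) :
    ∏ j ∈ Finset.range N, (1 - q ^ (n + j)) ∈ Set.Icc (0 : ℝ) 1 := by
  have hle (j : ℕ) : q ^ (n + j) ≤ 1 := pow_le_one₀ hq0.le hq1.le
  exact ⟨Finset.prod_nonneg fun j _ => by linarith [hle j],
    Finset.prod_le_one (fun j _ => by linarith [hle j])
      fun j _ => by linarith [pow_pos hq0 (n + j)]⟩

theorem one_sub_prod_one_sub_pow_le {q : ℝ} (hq0 : 0 < q) (hq1 : q < 1) (n N : ℕ) :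
    1 - ∏ j ∈ Finset.range N, (1 - q ^ (n + j)) ≤ q ^ n / (1 - q) := by
  have h : 1 - ∏ j ∈ Finset.range N, (1 - q ^ (n + j)) ≤ q ^ n * (1 - q ^ N) / (1 - q) := by
    induction N with
    | zero => simp
    | succ N ih =>
      rw [Finset.prod_range_succ]
      have h1 := (prod_one_sub_pow_mem_Icc hq0 hq1 n N).2
      have h2 := mul_le_mul_of_nonneg_left h1 (pow_pos hq0 (n + N)).le
      have h3 : q ^ n * (1 - q ^ (N + 1)) / (1 - q) =
          q ^ n * (1 - q ^ N) / (1 - q) + q ^ (n + N) := by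
        have : 1 - q ≠ 0 := (sub_pos.2 hq1).ne'
        field_simp
        ring
      rw [h3]
      linarith
  refine h.trans (div_le_div_of_nonneg_right ?_ (by linarith))
  exact mul_le_of_le_one_right (by positivity) (by linarith [pow_pos hq0 N])

theorem tendsto_prod_one_sub_pow_atTop {q : ℝ} (hq0 : 0 < q) (hq1 : q < 1) (N : ℕ) :
    Filter.Tendsto (fun n : ℕ => ∏ j ∈ Finset.range N, (1 - q ^ (n + j)))
      Filter.atTop (nhds 1) := by
  have h : Filter.Tendsto (fun n : ℕ => ∏ j ∈ Finset.range N, (1 - q ^ (n + j)))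
      Filter.atTop (nhds (∏ _j ∈ Finset.range N, (1 - 0))) :=
    tendsto_finsetProd _ fun j _ => tendsto_const_nhds.sub
      ((tendsto_pow_atTop_nhds_zero_of_lt_one hq0.le hq1).comp (Filter.tendsto_add_atTop_nat j))
  simpa using h

/-- The finite form of the identity, with products truncated to `N` factors. -/
theorem hasSum_one_sub_prod_one_sub_pow {q : ℝ} (hq0 : 0 < q) (hq1 : q < 1) (N : ℕ) :
    HasSum (fun n : ℕ => 1 - ∏ j ∈ Finset.range N, (1 - q ^ (n + 1 + j)))
      (∑ k ∈ Finset.range N, q ^ (k + 1) / (1 - q ^ (k + 1))) := by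
  induction N with
  | zero => simp
  | succ N ih =>
    rw [Finset.sum_range_succ]
    set A : ℕ → ℕ → ℝ := fun M n => ∏ j ∈ Finset.range M, (1 - q ^ (n + j)) with hA
    have hne : 1 - q ^ (N + 1) ≠ 0 :=
      (sub_pos.2 (pow_lt_one₀ hq0.le hq1 N.succ_ne_zero)).ne'
    have hright (n : ℕ) : A (N + 1) n = A N n * (1 - q ^ (n + N)) :=
      Finset.prod_range_succ _ _
    have hleft (n : ℕ) : A (N + 1) n = A N (n + 1) * (1 - q ^ n) := by
      simp only [hA, Finset.prod_range_succ', add_zero]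
      congr 1
      exact Finset.prod_congr rfl fun j _ => by rw [add_right_comm, add_assoc]
    have hdiff (n : ℕ) : A N (n + 1) * q ^ (n + 1 + N) =
        q ^ (N + 1) / (1 - q ^ (N + 1)) * (A (N + 1) (n + 1) - A (N + 1) n) := by
      rw [hright (n + 1), hleft n]
      field_simp
      ring
    have htel : HasSum (fun n => A N (n + 1) * q ^ (n + 1 + N))
        (q ^ (N + 1) / (1 - q ^ (N + 1))) := by
      have hnonneg (n : ℕ) : 0 ≤ A N (n + 1) * q ^ (n + 1 + N) :=
        mul_nonneg (prod_one_sub_pow_mem_Icc hq0 hq1 (n + 1) N).1 (by positivity)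
      rw [hasSum_iff_tendsto_nat_of_nonneg hnonneg]
      have h0 : A (N + 1) 0 = 0 := by simp [hleft]
      simp_rw [hdiff, ← Finset.mul_sum, Finset.sum_range_sub, h0, sub_zero]
      simpa using (tendsto_prod_one_sub_pow_atTop hq0 hq1 (N + 1)).const_mul
        (q ^ (N + 1) / (1 - q ^ (N + 1)))
    refine (ih.add htel).congr_fun ?_
    intro n
    change 1 - A (N + 1) (n + 1) = 1 - A N (n + 1) + _
    rw [hright]
    ring

theorem tendsto_prod_one_sub_pow_tprod {q : ℝ} (hq0 : 0 < q) (hq1 : q < 1) (n : ℕ) :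
    Filter.Tendsto (fun N : ℕ => ∏ j ∈ Finset.range N, (1 - q ^ (n + j)))
      Filter.atTop (nhds (∏' j : ℕ, (1 - q ^ (n + j)))) := by
  have hs : Summable fun j : ℕ => ‖-q ^ (n + j)‖ := by
    simp_rw [norm_neg, norm_pow, Real.norm_of_nonneg hq0.le, pow_add]
    exact (summable_geometric_of_lt_one hq0.le hq1).mul_left _
  simpa [sub_eq_add_neg] using (multipliable_one_add_of_summable hs).hasProd.tendsto_prod_nat

theorem stmt10 (q : ℝ) (hq0 : 0 < q) (hq1 : q < 1) :
    Summable (fun k : ℕ => q ^ (k + 1) / (1 - q ^ (k + 1))) ∧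
      Summable (fun n : ℕ => 1 - ∏' j : ℕ, (1 - q ^ (n + 1 + j))) ∧
      ∑' k : ℕ, q ^ (k + 1) / (1 - q ^ (k + 1)) =
        ∑' n : ℕ, (1 - ∏' j : ℕ, (1 - q ^ (n + 1 + j))) := by
  have hbound : Summable fun n : ℕ => q ^ (n + 1) / (1 - q) :=
    ((summable_nat_add_iff 1).2 (summable_geometric_of_lt_one hq0.le hq1)).div_const (1 - q)
  have hlim (n : ℕ) := (tendsto_prod_one_sub_pow_tprod hq0 hq1 (n + 1)).const_sub 1
  have hLambert := summable_pow_div_one_sub_pow hq0 hq1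
  refine ⟨hLambert, Summable.of_nonneg_of_le (fun n => ?_) (fun n => ?_) hbound, ?_⟩
  · exact ge_of_tendsto' (hlim n) fun N =>
      sub_nonneg.2 (prod_one_sub_pow_mem_Icc hq0 hq1 (n + 1) N).2
  · exact le_of_tendsto' (hlim n) (one_sub_prod_one_sub_pow_le hq0 hq1 (n + 1))
  · refine tendsto_nhds_unique hLambert.hasSum.tendsto_sum_nat ?_
    simp_rw [← fun N => (hasSum_one_sub_prod_one_sub_pow hq0 hq1 N).tsum_eq]
    refine tendsto_tsum_of_dominated_convergence hbound hlim (Filter.Eventually.of_forall ?_)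
    intro N n
    rw [Real.norm_of_nonneg (sub_nonneg.2 (prod_one_sub_pow_mem_Icc hq0 hq1 (n + 1) N).2)]
    exact one_sub_prod_one_sub_pow_le hq0 hq1 (n + 1) N
end

section
/- Fix 0 < q < 1, let c_q = ∑_{k=1}^∞ q^k/(1-q^k), and for integers k ≥ 1, j ≥ k define w_k(j) = ∑_{p_1+...+p_k=j, p_i≥1} ∏_{i=1}^k q^{2p_i}/(1-q^{p_i}), with w_0(0) = 1 and w_0(j) = 0 for j ≥ 1 and w_k(j) = 0 for j < k. Define g : [0,∞) → ℝ by g(x) = e^{−(1+c_q)x} ∑_{j=0}^{⌊x/log(1/q)⌋} q^{−j(1+c_q)} ∑_{k=0}^{j} ((x − j·log(1/q))^k / k!) · w_k(j). Then for every complex z with Re z > 0, ∫_0^∞ e^{−xz} g(x) dx = (1-q)/f_q(z+1), where f_q(z) = (1-q)(z + ∑_{k=1}^∞ q^k (1-q^{kz})/(1-q^k)). -/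
open MeasureTheory

/-- `c_q = ∑_{k=1}^∞ q^k/(1-q^k)`. -/
noncomputable def cq (q : ℝ) : ℝ := ∑' k : ℕ, q ^ (k + 1) / (1 - q ^ (k + 1))

/-- `w q k j = ∑_{p_1+⋯+p_k=j, p_i ≥ 1} ∏_i q^{2 p_i}/(1-q^{p_i})`, the mass at
`j log(1/q)` of the `k`-th convolution power of `∑_{p≥1} (q^{2p}/(1-q^p)) δ_{p log(1/q)}`. -/
noncomputable def w (q : ℝ) (k j : ℕ) : ℝ :=
  ∑ p ∈ (Finset.Nat.antidiagonalTuple k j).filter (fun p => ∀ i, 1 ≤ p i),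
    ∏ i, q ^ (2 * p i) / (1 - q ^ (p i))

/-- `(1-q)` times the density of the measure `τ_q`. -/
noncomputable def g (q : ℝ) (x : ℝ) : ℝ :=
  Real.exp (-(1 + cq q) * x) *
    ∑ j ∈ Finset.range (⌊x / Real.log (1 / q)⌋₊ + 1),
      q ^ (-(j : ℝ) * (1 + cq q)) *
        ∑ k ∈ Finset.range (j + 1),
          (x - j * Real.log (1 / q)) ^ k / (Nat.factorial k) * w q k j

theorem w_eq_sum_antidiagonalTuple (q : ℝ) (k j : ℕ) :
    w q k j = ∑ p ∈ Finset.Nat.antidiagonalTuple k j, ∏ i, q ^ (2 * p i) / (1 - q ^ (p i)) := by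
  refine Finset.sum_filter_of_ne fun p _ hp i => ?_
  by_contra hi
  refine hp (Finset.prod_eq_zero (Finset.mem_univ i) ?_)
  simp [show p i = 0 by omega]

theorem w_zero_zero (q : ℝ) : w q 0 0 = 1 := by
  simp [w_eq_sum_antidiagonalTuple]

theorem w_zero_succ (q : ℝ) (j : ℕ) : w q 0 (j + 1) = 0 := by
  simp [w_eq_sum_antidiagonalTuple]

theorem w_eq_zero_of_lt (q : ℝ) {k j : ℕ} (h : j < k) : w q k j = 0 := by
  refine Finset.sum_eq_zero fun p hp => ?_
  rw [Finset.mem_filter, Finset.Nat.mem_antidiagonalTuple] at hp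
  have : ∑ _i : Fin k, 1 ≤ ∑ i, p i := Finset.sum_le_sum fun i _ => hp.2 i
  simp only [Finset.sum_const, Finset.card_univ, Fintype.card_fin, smul_eq_mul, mul_one] at this
  omega

theorem w_nonneg {q : ℝ} (hq0 : 0 ≤ q) (hq1 : q ≤ 1) (k j : ℕ) : 0 ≤ w q k j :=
  Finset.sum_nonneg fun _ _ => Finset.prod_nonneg fun _ _ =>
    div_nonneg (pow_nonneg hq0 _) (sub_nonneg.2 (pow_le_one₀ hq0 hq1))

theorem w_succ (q : ℝ) (k j : ℕ) :
    w q (k + 1) j =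
      ∑ x ∈ Finset.HasAntidiagonal.antidiagonal j, q ^ (2 * x.1) / (1 - q ^ x.1) * w q k x.2 := by
  simp only [w_eq_sum_antidiagonalTuple, Finset.mul_sum]
  rw [Finset.sum_sigma']
  refine Finset.sum_nbij' (fun p => ⟨(p 0, ∑ i, Fin.tail p i), Fin.tail p⟩)
    (fun x => Fin.cons x.1.1 x.2) ?_ ?_ ?_ ?_ ?_
  · intro p hp
    rw [Finset.Nat.mem_antidiagonalTuple, Fin.sum_univ_succ] at hp
    simpa [Finset.Nat.mem_antidiagonalTuple, Fin.tail] using hp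
  · rintro ⟨⟨a, b⟩, p⟩ hp
    simp only [Finset.mem_sigma, Finset.HasAntidiagonal.mem_antidiagonal,
      Finset.Nat.mem_antidiagonalTuple] at hp
    simp [Finset.Nat.mem_antidiagonalTuple, Fin.sum_univ_succ, hp]
  · intro p _
    simp
  · rintro ⟨⟨a, b⟩, p⟩ hp
    simp only [Finset.mem_sigma, Finset.HasAntidiagonal.mem_antidiagonal,
      Finset.Nat.mem_antidiagonalTuple] at hp
    simp [hp]
  · intro p _
    simp only [Fin.prod_univ_succ, Fin.tail]


/-- The generating function of the `k`-fold convolution power is the `k`-th power of the generating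
function of the jump measure. -/
theorem summable_and_tsum_w_smul_pow {A : Type*} [NormedCommRing A] [NormedAlgebra ℝ A]
    [CompleteSpace A] {q : ℝ} {u : A}
    (hu : Summable fun p : ℕ => ‖(q ^ (2 * p) / (1 - q ^ p)) • u ^ p‖) (k : ℕ) :
    (Summable fun j : ℕ => ‖w q k j • u ^ j‖) ∧
      ∑' j : ℕ, w q k j • u ^ j = (∑' p : ℕ, (q ^ (2 * p) / (1 - q ^ p)) • u ^ p) ^ k := by
  induction k with
  | zero =>
    have h0 : ∀ j ≠ 0, w q 0 j • u ^ j = 0 := by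
      rintro (_ | j) hj
      · exact absurd rfl hj
      · simp [w_zero_succ]
    refine ⟨summable_of_ne_finset_zero (s := {0}) fun j hj => ?_, ?_⟩
    · rw [h0 j (by simpa using hj), norm_zero]
    · rw [tsum_eq_single 0 h0]
      simp [w_zero_zero]
  | succ k ih =>
    have h : ∀ j, w q (k + 1) j • u ^ j = ∑ x ∈ Finset.HasAntidiagonal.antidiagonal j,
        ((q ^ (2 * x.1) / (1 - q ^ x.1)) • u ^ x.1) * (w q k x.2 • u ^ x.2) := by
      intro j
      rw [w_succ, Finset.sum_smul]
      refine Finset.sum_congr rfl fun x hx => ?_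
      rw [← Finset.HasAntidiagonal.mem_antidiagonal.1 hx, pow_add, smul_mul_smul_comm]
    simp only [h]
    have hsum := summable_norm_sum_mul_antidiagonal_of_summable_norm hu ih.1
    have heq := tsum_mul_tsum_eq_tsum_sum_antidiagonal_of_summable_norm hu ih.1
    refine ⟨hsum, ?_⟩
    rw [← heq, ih.2, pow_succ']

theorem summable_cq {q : ℝ} (hq0 : 0 < q) (hq1 : q < 1) :
    Summable fun k : ℕ => q ^ (k + 1) / (1 - q ^ (k + 1)) := by
  have h : Summable fun k : ℕ => q ^ k * (q / (1 - q)) :=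
    (summable_geometric_of_lt_one hq0.le hq1).mul_right _
  have hpow (k : ℕ) : q ^ (k + 1) ≤ q := pow_le_of_le_one hq0.le hq1.le k.succ_ne_zero
  refine h.of_nonneg_of_le (fun k => div_nonneg (by positivity) (by linarith [hpow k])) fun k => ?_
  rw [pow_succ, mul_div_assoc]
  have := hpow k
  rw [pow_succ] at this
  gcongr

theorem jump_le {q : ℝ} (hq0 : 0 < q) (hq1 : q < 1) (k : ℕ) :
    q ^ (2 * (k + 1)) / (1 - q ^ (k + 1)) ≤ q ^ (k + 1) / (1 - q ^ (k + 1)) := by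
  have : q ^ (k + 1) ≤ 1 := pow_le_one₀ hq0.le hq1.le
  refine div_le_div_of_nonneg_right ?_ (by linarith)
  exact pow_le_pow_of_le_one hq0.le hq1.le (by omega)

theorem jump_nonneg {q : ℝ} (hq0 : 0 < q) (hq1 : q < 1) (p : ℕ) :
    0 ≤ q ^ (2 * p) / (1 - q ^ p) :=
  div_nonneg (by positivity) (sub_nonneg.2 (pow_le_one₀ hq0.le hq1.le))

theorem summable_jump {q : ℝ} (hq0 : 0 < q) (hq1 : q < 1) :
    Summable fun p : ℕ => q ^ (2 * p) / (1 - q ^ p) :=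
  (summable_nat_add_iff 1).1 <| (summable_cq hq0 hq1).of_nonneg_of_le
    (fun k => jump_nonneg hq0 hq1 (k + 1)) (jump_le hq0 hq1)

theorem tsum_jump_le_cq {q : ℝ} (hq0 : 0 < q) (hq1 : q < 1) :
    ∑' p : ℕ, q ^ (2 * p) / (1 - q ^ p) ≤ cq q := by
  rw [(summable_jump hq0 hq1).tsum_eq_zero_add]
  simp only [mul_zero, pow_zero, sub_self, div_zero, zero_add]
  exact ((summable_nat_add_iff 1).2 (summable_jump hq0 hq1)).tsum_le_tsum
    (jump_le hq0 hq1) (summable_cq hq0 hq1)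

theorem norm_jump_smul_pow_le {q : ℝ} (hq0 : 0 < q) (hq1 : q < 1) {A : Type*} [NormedField A]
    [NormedAlgebra ℝ A] {u : A} (hu : ‖u‖ ≤ 1) (p : ℕ) :
    ‖(q ^ (2 * p) / (1 - q ^ p)) • u ^ p‖ ≤ q ^ (2 * p) / (1 - q ^ p) := by
  rw [norm_smul, norm_pow, Real.norm_of_nonneg (jump_nonneg hq0 hq1 p)]
  exact mul_le_of_le_one_right (jump_nonneg hq0 hq1 p) (pow_le_one₀ (norm_nonneg _) hu)

theorem summable_norm_jump_smul_pow {q : ℝ} (hq0 : 0 < q) (hq1 : q < 1) {A : Type*}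
    [NormedField A] [NormedAlgebra ℝ A] {u : A} (hu : ‖u‖ ≤ 1) :
    Summable fun p : ℕ => ‖(q ^ (2 * p) / (1 - q ^ p)) • u ^ p‖ :=
  (summable_jump hq0 hq1).of_nonneg_of_le (fun _ => norm_nonneg _)
    (norm_jump_smul_pow_le hq0 hq1 hu)

theorem norm_tsum_jump_smul_pow_le {q : ℝ} (hq0 : 0 < q) (hq1 : q < 1) {A : Type*}
    [NormedField A] [NormedAlgebra ℝ A] {u : A} (hu : ‖u‖ ≤ 1) :
    ‖∑' p : ℕ, (q ^ (2 * p) / (1 - q ^ p)) • u ^ p‖ ≤ cq q :=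
  (tsum_of_norm_bounded (summable_jump hq0 hq1).hasSum (norm_jump_smul_pow_le hq0 hq1 hu)).trans
    (tsum_jump_le_cq hq0 hq1)

theorem hasSum_pow_div_pow_succ {A : Type*} [NormedField A] [CompleteSpace A] {W s : A}
    (h : ‖W‖ < ‖s‖) :
    HasSum (fun k : ℕ => W ^ k / s ^ (k + 1)) (1 / (s - W)) := by
  have hs : s ≠ 0 := norm_pos_iff.1 ((norm_nonneg W).trans_lt h)
  have hsub : s - W ≠ 0 := sub_ne_zero.2 fun e => h.ne (by rw [e])
  have hr : ‖W / s‖ < 1 := by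
    rw [norm_div]; exact (div_lt_one (norm_pos_iff.2 hs)).2 h
  convert! (hasSum_geometric_of_norm_lt_one hr).mul_right (1 / s) using 1
  · ext k
    rw [div_pow, pow_succ]
    field_simp
  · have : 1 - W / s = (s - W) / s := by field_simp
    rw [this]
    field_simp

theorem summable_w_smul_pow_div_real {q : ℝ} (hq0 : 0 < q) (hq1 : q < 1) {r t : ℝ} (hr0 : 0 ≤ r)
    (hr1 : r ≤ 1) (ht : cq q < t) :
    Summable fun x : ℕ × ℕ => w q x.1 x.2 * r ^ x.2 / t ^ (x.1 + 1) := by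
  have hr : ‖r‖ ≤ 1 := by rwa [Real.norm_of_nonneg hr0]
  have hW := norm_tsum_jump_smul_pow_le hq0 hq1 hr
  have ht0 : 0 < t := ((norm_nonneg _).trans hW).trans_lt ht
  have hgen := summable_and_tsum_w_smul_pow (summable_norm_jump_smul_pow hq0 hq1 hr)
  simp only [smul_eq_mul] at hgen hW
  have hnonneg : 0 ≤ fun x : ℕ × ℕ => w q x.1 x.2 * r ^ x.2 / t ^ (x.1 + 1) := fun x =>
    div_nonneg (mul_nonneg (w_nonneg hq0.le hq1.le _ _) (pow_nonneg hr0 _))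
      (pow_nonneg ht0.le _)
  refine (summable_prod_of_nonneg hnonneg).2 ⟨fun k => ?_, ?_⟩
  · have h : Summable fun j => w q k j * r ^ j := Summable.of_norm (hgen k).1
    exact h.div_const (t ^ (k + 1))
  · have h := hasSum_pow_div_pow_succ (hW.trans_lt (ht.trans_le (le_abs_self t)))
    refine h.summable.congr fun k => ?_
    dsimp only
    rw [tsum_div_const, (hgen k).2]

theorem hasSum_w_smul_pow_div {q : ℝ} (hq0 : 0 < q) (hq1 : q < 1) {u s : ℂ} (hu : ‖u‖ ≤ 1)
    (hs : cq q < ‖s‖) :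
    HasSum (fun x : ℕ × ℕ => w q x.1 x.2 • u ^ x.2 / s ^ (x.1 + 1))
      (1 / (s - ∑' p : ℕ, (q ^ (2 * p) / (1 - q ^ p)) • u ^ p)) := by
  have hsum : Summable fun x : ℕ × ℕ => w q x.1 x.2 • u ^ x.2 / s ^ (x.1 + 1) := by
    refine Summable.of_norm ?_
    convert! summable_w_smul_pow_div_real hq0 hq1 (norm_nonneg u) hu hs using 2 with x
    rw [norm_div, norm_smul, norm_pow, norm_pow, Real.norm_of_nonneg (w_nonneg hq0.le hq1.le _ _)]
  have hgen := summable_and_tsum_w_smul_pow (summable_norm_jump_smul_pow hq0 hq1 hu)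
  have hfib (k : ℕ) := ((hgen k).1.of_norm.hasSum.div_const (s ^ (k + 1)))
  have h := hsum.hasSum.prod_fiberwise hfib
  simp only [(hgen _).2] at h
  rw [← h.unique (hasSum_pow_div_pow_succ ((norm_tsum_jump_smul_pow_le hq0 hq1 hu).trans_lt hs))]
  exact hsum.hasSum

/-- The density of an Erlang distribution of shape `k + 1`, up to normalization, with complex
rate. -/
noncomputable def erlangKernel (s : ℂ) (k : ℕ) : ℝ → ℂ :=
  (Set.Ici 0).indicator fun t => Complex.exp (-(s * t)) * ((t ^ k / k.factorial : ℝ) : ℂ)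

theorem norm_erlangKernel (s : ℂ) (k : ℕ) (t : ℝ) :
    (‖erlangKernel s k t‖ : ℂ) = erlangKernel s.re k t := by
  by_cases ht : t ∈ Set.Ici (0 : ℝ)
  · have : 0 ≤ t ^ k / k.factorial := div_nonneg (pow_nonneg ht _) (by positivity)
    simp only [erlangKernel, Set.indicator_of_mem ht]
    rw [norm_mul, Complex.norm_exp, Complex.norm_real, Real.norm_of_nonneg this]
    push_cast
    simp
  · simp [erlangKernel, Set.indicator_of_notMem ht]

theorem integrable_erlangKernel {s : ℂ} (hs : 0 < s.re) (k : ℕ) :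
    Integrable (erlangKernel s k) := by
  rw [erlangKernel, integrable_indicator_iff measurableSet_Ici, integrableOn_Ici_iff_integrableOn_Ioi]
  have h := (integrableOn_rpow_mul_exp_neg_mul_rpow (s := k) (p := 1) (b := s.re)
    (by linarith [k.cast_nonneg (α := ℝ)]) one_pos hs).div_const (k.factorial : ℝ)
  refine h.mono' (by fun_prop) ?_
  filter_upwards [ae_restrict_mem measurableSet_Ioi] with t ht
  have : 0 ≤ t ^ k / k.factorial := div_nonneg (pow_nonneg (le_of_lt ht) _) (by positivity)
  rw [norm_mul, Complex.norm_exp, Complex.norm_real, Real.norm_of_nonneg this]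
  apply le_of_eq
  simp
  ring

theorem integral_erlangKernel {s : ℂ} (hs : 0 < s.re) (k : ℕ) :
    ∫ t, erlangKernel s k t = 1 / s ^ (k + 1) := by
  have hs0 : s ≠ 0 := fun h => by simp [h] at hs
  have h_int (k : ℕ) : IntegrableOn
      (fun t : ℝ => Complex.exp (-(s * t)) * ((t ^ k / k.factorial : ℝ) : ℂ)) (Set.Ioi 0) := by
    rw [← integrableOn_Ici_iff_integrableOn_Ioi, ← integrable_indicator_iff measurableSet_Ici]
    exact integrable_erlangKernel hs k
  have hexp (t : ℝ) : HasDerivAt (fun t : ℝ => Complex.exp (-(s * t)))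
      (Complex.exp (-(s * t)) * -s) t := by
    simpa using (((Complex.ofRealCLM.hasDerivAt (x := t)).const_mul s).neg).cexp
  have hpow (k : ℕ) (t : ℝ) : HasDerivAt (fun t : ℝ => ((t ^ (k + 1) / (k + 1).factorial : ℝ) : ℂ))
      ((t ^ k / k.factorial : ℝ) : ℂ) t := by
    have h := ((hasDerivAt_pow (k + 1) t).div_const ((k + 1).factorial : ℝ)).ofReal_comp
    convert! h using 2
    rw [Nat.factorial_succ]
    push_cast
    field_simp
  have hlim (k : ℕ) : Filter.Tendsto
      (fun t : ℝ => Complex.exp (-(s * t)) * ((t ^ k / k.factorial : ℝ) : ℂ))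
      Filter.atTop (nhds 0) := by
    rw [tendsto_zero_iff_norm_tendsto_zero]
    have h := (tendsto_rpow_mul_exp_neg_mul_atTop_nhds_zero k s.re hs).div_const (k.factorial : ℝ)
    rw [zero_div] at h
    refine h.congr' ?_
    filter_upwards [Filter.eventually_ge_atTop 0] with t ht
    have : 0 ≤ t ^ k / k.factorial := by positivity
    rw [norm_mul, Complex.norm_exp, Complex.norm_real, Real.norm_of_nonneg this]
    simp
    ring
  rw [erlangKernel, integral_indicator measurableSet_Ici, integral_Ici_eq_integral_Ioi]
  induction k with
  | zero =>
    have h := integral_Ioi_of_hasDerivAt_of_tendsto' (a := 0)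
      (fun t _ => (hexp t).mul_const (-1 / s)) (by
        refine (h_int 0).congr_fun (fun t _ => ?_) measurableSet_Ioi
        simp
        field_simp) (m := 0) (by simpa using (hlim 0).mul_const (-1 / s))
    have e (t : ℝ) : Complex.exp (-(s * t)) * -s * (-1 / s) = Complex.exp (-(s * t)) := by
      field_simp
    simp only [e] at h
    simpa [neg_div] using h
  | succ k ih =>
    have e (t : ℝ) : (Complex.exp (-(s * t)) * -s * ((t ^ (k + 1) / (k + 1).factorial : ℝ) : ℂ) +
        Complex.exp (-(s * t)) * ((t ^ k / k.factorial : ℝ) : ℂ)) =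
        -s * (Complex.exp (-(s * t)) * ((t ^ (k + 1) / (k + 1).factorial : ℝ) : ℂ)) +
        Complex.exp (-(s * t)) * ((t ^ k / k.factorial : ℝ) : ℂ) := by ring
    have h := integral_Ioi_of_hasDerivAt_of_tendsto' (a := 0)
      (fun t _ => (hexp t).mul (hpow k t)) (by
        simp only [e]
        exact ((h_int (k + 1)).const_mul _).add (h_int k)) (hlim (k + 1))
    simp only [e] at h
    rw [integral_add ((h_int (k + 1)).const_mul _) (h_int k), integral_const_mul, ih] at h
    simp only [Pi.mul_apply, zero_pow k.succ_ne_zero, Complex.ofReal_zero, mul_zero, zero_div,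
      sub_zero] at h
    rw [neg_mul, neg_add_eq_zero] at h
    rw [pow_succ s (k + 1), ← div_div, ← h]
    field_simp

theorem integral_norm_erlangKernel {s : ℂ} (hs : 0 < s.re) (k : ℕ) :
    ∫ t, ‖erlangKernel s k t‖ = 1 / s.re ^ (k + 1) := by
  rw [← Complex.ofReal_inj, ← integral_complex_ofReal]
  simp only [norm_erlangKernel]
  rw [integral_erlangKernel (by simpa using hs)]
  push_cast
  rfl

theorem integrable_const_mul_erlangKernel_sub (c : ℂ) {s : ℂ} (hs : 0 < s.re) (k : ℕ) (a : ℝ) :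
    Integrable fun x => c * erlangKernel s k (x - a) :=
  ((integrable_erlangKernel hs k).comp_sub_right a).const_mul c

/-- The terms of the renewal series of `g`, after multiplication with the Laplace kernel. -/
noncomputable def laplaceTerm (q : ℝ) (u s : ℂ) (x : ℕ × ℕ) (t : ℝ) : ℂ :=
  w q x.1 x.2 • u ^ x.2 * erlangKernel s x.1 (t - x.2 * Real.log (1 / q))

theorem integral_tsum_laplaceTerm {q : ℝ} (hq0 : 0 < q) (hq1 : q < 1) {u s : ℂ} (hu : ‖u‖ ≤ 1)
    (hs : cq q < s.re) (hs0 : 0 < s.re) :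
    ∫ t, ∑' x, laplaceTerm q u s x t =
      1 / (s - ∑' p : ℕ, (q ^ (2 * p) / (1 - q ^ p)) • u ^ p) := by
  have h_int (x : ℕ × ℕ) : Integrable (laplaceTerm q u s x) :=
    integrable_const_mul_erlangKernel_sub _ hs0 _ _
  have hnorm (x : ℕ × ℕ) :
      ∫ t, ‖laplaceTerm q u s x t‖ = w q x.1 x.2 * ‖u‖ ^ x.2 / s.re ^ (x.1 + 1) := by
    simp only [laplaceTerm, norm_mul, norm_smul, norm_pow]
    rw [integral_const_mul, integral_sub_right_eq_self (fun t => ‖erlangKernel s x.1 t‖),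
      integral_norm_erlangKernel hs0, Real.norm_of_nonneg (w_nonneg hq0.le hq1.le _ _),
      mul_one_div]
  have hval (x : ℕ × ℕ) :
      ∫ t, laplaceTerm q u s x t = w q x.1 x.2 • u ^ x.2 / s ^ (x.1 + 1) := by
    simp only [laplaceTerm]
    rw [integral_const_mul, integral_sub_right_eq_self (erlangKernel s x.1),
      integral_erlangKernel hs0, mul_one_div]
  have h := hasSum_integral_of_summable_integral_norm h_int (by
    simp only [hnorm]
    exact summable_w_smul_pow_div_real hq0 hq1 (norm_nonneg u) hu hs)
  simp only [hval] at h
  exact h.unique (hasSum_w_smul_pow_div hq0 hq1 hu (hs.trans_le (Complex.re_le_norm s)))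

theorem laplaceTerm_apply {q : ℝ} (hq0 : 0 < q) (z : ℂ) (k j : ℕ) {t : ℝ}
    (h : j * Real.log (1 / q) ≤ t) :
    laplaceTerm q ((q : ℂ) ^ z) (z + (1 + cq q : ℝ)) (k, j) t =
      Complex.exp (-(t : ℂ) * z) * ((Real.exp (-(1 + cq q) * t) * (q ^ (-(j : ℝ) * (1 + cq q)) *
        ((t - j * Real.log (1 / q)) ^ k / k.factorial * w q k j)) : ℝ) : ℂ) := by
  have hq : (q : ℂ) ≠ 0 := by exact_mod_cast hq0.ne'
  have hmem : t - j * Real.log (1 / q) ∈ Set.Ici (0 : ℝ) := sub_nonneg.2 h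
  have hexp : Complex.exp (-(t : ℂ) * z) * Complex.exp (-(1 + cq q) * t) *
      Complex.exp (Real.log q * (-j * (1 + cq q))) =
      Complex.exp (j * (Real.log q * z)) *
        Complex.exp (-((z + (1 + cq q)) * (t - j * -Real.log q))) := by
    simp only [← Complex.exp_add]
    congr 1
    ring
  rw [laplaceTerm, erlangKernel, Set.indicator_of_mem hmem, Real.rpow_def_of_pos hq0,
    Complex.cpow_def_of_ne_zero hq, ← Complex.exp_nat_mul, ← Complex.ofReal_log hq0.le,
    one_div, Real.log_inv, Complex.real_smul]
  push_cast
  linear_combination (-(w q k j : ℂ) * (t - j * -Real.log q) ^ k / k.factorial) * hexp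

theorem laplaceTerm_eq_zero {q : ℝ} (u s : ℂ) (x : ℕ × ℕ) {t : ℝ}
    (h : x.2 < x.1 ∨ t < x.2 * Real.log (1 / q)) : laplaceTerm q u s x t = 0 := by
  rw [laplaceTerm]
  rcases h with h | h
  · rw [w_eq_zero_of_lt q h, zero_smul, zero_mul]
  · rw [erlangKernel, Set.indicator_of_notMem, mul_zero]
    exact not_le.2 (sub_neg.2 h)

theorem tsum_laplaceTerm {q : ℝ} (hq0 : 0 < q) (hq1 : q < 1) (z : ℂ) (t : ℝ) :
    ∑' x, laplaceTerm q ((q : ℂ) ^ z) (z + (1 + cq q : ℝ)) x t =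
      (Set.Ici 0).indicator (fun t : ℝ => Complex.exp (-(t : ℂ) * z) * (g q t : ℂ)) t := by
  have hlog : 0 < Real.log (1 / q) := Real.log_pos ((one_lt_div hq0).2 hq1)
  by_cases ht : 0 ≤ t
  · have hfloor (j : ℕ) : j * Real.log (1 / q) ≤ t ↔ j < ⌊t / Real.log (1 / q)⌋₊ + 1 := by
      rw [Nat.lt_succ_iff, Nat.le_floor_iff (by positivity), le_div_iff₀ hlog]
    set N := ⌊t / Real.log (1 / q)⌋₊ + 1 with hN
    rw [Set.indicator_of_mem (Set.mem_Ici.2 ht), tsum_eq_sum (s := Finset.range N ×ˢ Finset.range N),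
      Finset.sum_product_right, g, ← hN]
    · simp only [Finset.mul_sum, Complex.ofReal_sum]
      refine Finset.sum_congr rfl fun j hj => ?_
      rw [Finset.mem_range] at hj
      symm
      rw [← Finset.sum_subset (Finset.range_subset_range.2 (Nat.succ_le_of_lt hj))]
      · exact Finset.sum_congr rfl fun k _ => (laplaceTerm_apply hq0 z k j ((hfloor j).2 hj)).symm
      · intro k _ hk
        refine laplaceTerm_eq_zero _ _ _ (Or.inl ?_)
        simpa using hk
    · rintro ⟨k, j⟩ hx
      refine laplaceTerm_eq_zero _ _ _ ?_
      by_contra! hc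
      have := (hfloor j).1 hc.2
      simp only [Finset.mem_product, Finset.mem_range] at hx
      exact hx ⟨by omega, this⟩
  · rw [Set.indicator_of_notMem (by simpa using ht)]
    rw [not_le] at ht
    have h (x : ℕ × ℕ) : laplaceTerm q ((q : ℂ) ^ z) (z + (1 + cq q : ℝ)) x t = 0 :=
      laplaceTerm_eq_zero _ _ _ (Or.inr (ht.trans_le (by positivity)))
    simp only [h, tsum_zero]

theorem norm_cpow_le_one {q : ℝ} (hq0 : 0 < q) (hq1 : q < 1) {z : ℂ} (hz : 0 ≤ z.re) :
    ‖(q : ℂ) ^ z‖ ≤ 1 := by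
  rw [Complex.norm_cpow_eq_rpow_re_of_pos hq0]
  exact Real.rpow_le_one hq0.le hq1.le hz

theorem fq_add_one {q : ℝ} (hq0 : 0 < q) (hq1 : q < 1) {z : ℂ} (hz : 0 ≤ z.re) :
    fq q (z + 1) = (1 - q) * (z + (1 + cq q : ℝ) -
      ∑' p : ℕ, (q ^ (2 * p) / (1 - q ^ p)) • ((q : ℂ) ^ z) ^ p) := by
  have hq : (q : ℂ) ≠ 0 := by exact_mod_cast hq0.ne'
  have hsum : Summable fun p : ℕ => (q ^ (2 * p) / (1 - q ^ p)) • ((q : ℂ) ^ z) ^ p :=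
    (summable_norm_jump_smul_pow hq0 hq1 (norm_cpow_le_one hq0 hq1 hz)).of_norm
  have hterm (k : ℕ) :
      (q : ℂ) ^ (k + 1) * (1 - (q : ℂ) ^ (((k : ℂ) + 1) * (z + 1))) / (1 - (q : ℂ) ^ (k + 1)) =
        ((q ^ (k + 1) / (1 - q ^ (k + 1)) : ℝ) : ℂ) -
          (q ^ (2 * (k + 1)) / (1 - q ^ (k + 1))) • ((q : ℂ) ^ z) ^ (k + 1) := by
    have : (q : ℂ) ^ (((k : ℂ) + 1) * (z + 1)) = (q : ℂ) ^ (k + 1) * ((q : ℂ) ^ z) ^ (k + 1) := by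
      rw [← Nat.cast_succ, Complex.cpow_nat_mul, Complex.cpow_add _ _ hq, Complex.cpow_one,
        mul_comm, mul_pow]
    rw [this, Complex.real_smul]
    push_cast
    ring
  rw [fq, hsum.tsum_eq_zero_add]
  simp only [hterm]
  rw [Summable.tsum_sub (Complex.summable_ofReal.2 (summable_cq hq0 hq1))
    ((summable_nat_add_iff 1).2 hsum), ← Complex.ofReal_tsum, ← cq]
  congr 1
  push_cast
  simp
  ring

theorem stmt13 (q : ℝ) (hq0 : 0 < q) (hq1 : q < 1) (z : ℂ) (hz : 0 < z.re) :
    ∫ x in Set.Ioi (0:ℝ), Complex.exp (-(x : ℂ) * z) * (g q x : ℂ) =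
      (1 - q) / fq q (z + 1) := by
  have hcq : 0 ≤ cq q := (norm_nonneg _).trans
    (norm_tsum_jump_smul_pow_le hq0 hq1 (norm_cpow_le_one hq0 hq1 hz.le))
  have hre : (z + (1 + cq q : ℝ)).re = z.re + (1 + cq q) := by simp
  have hq : (1 - q : ℂ) ≠ 0 := by exact_mod_cast (sub_pos.2 hq1).ne'
  rw [← integral_Ici_eq_integral_Ioi, ← integral_indicator measurableSet_Ici,
    fq_add_one hq0 hq1 hz.le, div_mul_cancel_left₀ hq, inv_eq_one_div,
    ← integral_tsum_laplaceTerm hq0 hq1 (norm_cpow_le_one hq0 hq1 hz.le)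
      (by rw [hre]; linarith) (by rw [hre]; linarith)]
  exact integral_congr_ae (Filter.Eventually.of_forall fun t => (tsum_laplaceTerm hq0 hq1 z t).symm)
end

section
/- Fix 0 < q < 1 and let g : [0,∞) → ℝ be defined by g(x) = e^{−(1+c_q)x} ∑_{j=0}^{⌊x/log(1/q)⌋} q^{−j(1+c_q)} ∑_{k=0}^{j} ((x − j·log(1/q))^k / k!) · w_k(j), where c_q = ∑_{k=1}^∞ q^k/(1-q^k) and w_k(j) = ∑_{p_1+...+p_k=j, p_i≥1} ∏_{i=1}^k q^{2p_i}/(1-q^{p_i}) (with w_0(0)=1, w_0(j)=0 for j≥1). Then g is infinitely differentiable on each open interval (n·log(1/q), (n+1)·log(1/q)) for n = 0, 1, 2, ..., and for each integer n ≥ 1 the right derivative minus the left derivative of g at x = n·log(1/q) equals q^{2n}/(1-q^n). -/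
open MeasureTheory

/-- The `j`-th summand of `g`. -/
noncomputable def gTerm (q : ℝ) (j : ℕ) (x : ℝ) : ℝ :=
  Real.exp (-(1 + cq q) * x) * (q ^ (-(j : ℝ) * (1 + cq q)) *
    ∑ k ∈ Finset.range (j + 1),
      (x - j * Real.log (1 / q)) ^ k / (Nat.factorial k) * w q k j)

/-- The smooth function that agrees with `g` on `[n log(1/q), (n+1) log(1/q))`. -/
noncomputable def gPartial (q : ℝ) (n : ℕ) (x : ℝ) : ℝ :=
  ∑ j ∈ Finset.range (n + 1), gTerm q j x

lemma contDiff_gTerm (q : ℝ) (j : ℕ) : ContDiff ℝ (⊤ : ℕ∞) (gTerm q j) := by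
  unfold gTerm
  fun_prop

lemma contDiff_gPartial (q : ℝ) (n : ℕ) : ContDiff ℝ (⊤ : ℕ∞) (gPartial q n) :=
  ContDiff.sum fun j _ => contDiff_gTerm q j

lemma log_one_div_pos {q : ℝ} (hq0 : 0 < q) (hq1 : q < 1) : 0 < Real.log (1 / q) :=
  Real.log_pos (by rw [lt_div_iff₀ hq0]; linarith)

lemma g_eq_gPartial {q : ℝ} (hq0 : 0 < q) (hq1 : q < 1) {n : ℕ} {x : ℝ}
    (h1 : (n : ℝ) * Real.log (1 / q) ≤ x) (h2 : x < ((n : ℝ) + 1) * Real.log (1 / q)) :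
    g q x = gPartial q n x := by
  have hL := log_one_div_pos hq0 hq1
  have hfloor : ⌊x / Real.log (1 / q)⌋₊ = n := by
    rw [Nat.floor_eq_iff (div_nonneg (le_trans (by positivity) h1) hL.le)]
    exact ⟨(le_div_iff₀ hL).2 h1, (div_lt_iff₀ hL).2 h2⟩
  simp only [g, gPartial, gTerm, hfloor, Finset.mul_sum]

lemma w_zero_left (q : ℝ) {n : ℕ} (hn : 1 ≤ n) : w q 0 n = 0 := by
  obtain ⟨m, rfl⟩ := Nat.exists_eq_add_of_le' hn
  simp [w]

lemma w_one_left (q : ℝ) {n : ℕ} (hn : 1 ≤ n) : w q 1 n = q ^ (2 * n) / (1 - q ^ n) := by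
  simp [w, Finset.filter_singleton, hn]

lemma gTerm_knot (q : ℝ) {n : ℕ} (hn : 1 ≤ n) :
    gTerm q n ((n : ℝ) * Real.log (1 / q)) = 0 := by
  simp [gTerm, Finset.sum_range_succ', w_zero_left q hn]

lemma hasDerivAt_gTerm_knot {q : ℝ} (hq0 : 0 < q) {n : ℕ} (hn : 1 ≤ n) :
    HasDerivAt (gTerm q n) (q ^ (2 * n) / (1 - q ^ n)) ((n : ℝ) * Real.log (1 / q)) := by
  set a := (n : ℝ) * Real.log (1 / q) with ha
  have hS : HasDerivAt
      (fun x : ℝ => ∑ k ∈ Finset.range (n + 1), (x - a) ^ k / (Nat.factorial k) * w q k n)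
      (∑ k ∈ Finset.range (n + 1), if k = 1 then w q 1 n else 0) a := by
    refine HasDerivAt.fun_sum fun k _ => ?_
    have h := ((((hasDerivAt_id a).sub_const a).pow k).div_const
      (Nat.factorial k : ℝ)).mul_const (w q k n)
    refine h.congr_deriv ?_
    rcases k with _ | _ | k <;> simp
  rw [Finset.sum_ite_eq', if_pos (by simp; omega)] at hS
  have hE : HasDerivAt (fun x : ℝ => Real.exp (-(1 + cq q) * x))
      (Real.exp (-(1 + cq q) * a) * (-(1 + cq q) * 1)) a :=
    ((hasDerivAt_id a).const_mul _).exp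
  have h := hE.mul (hS.const_mul (q ^ (-(n : ℝ) * (1 + cq q))))
  have hS0 : ∑ k ∈ Finset.range (n + 1), (a - a) ^ k / (Nat.factorial k) * w q k n = 0 := by
    simp [Finset.sum_range_succ', w_zero_left q hn]
  have hexp : Real.exp (-(1 + cq q) * a) * q ^ (-(n : ℝ) * (1 + cq q)) = 1 := by
    rw [Real.rpow_def_of_pos hq0, ← Real.exp_add, ha, one_div, Real.log_inv, Real.exp_eq_one_iff]
    ring
  refine h.congr_deriv ?_
  rw [hS0, ← w_one_left q hn, mul_zero, mul_zero, zero_add, ← mul_assoc, hexp, one_mul]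

theorem stmt15 (q : ℝ) (hq0 : 0 < q) (hq1 : q < 1) :
    (∀ n : ℕ, ContDiffOn ℝ (⊤ : ℕ∞) (g q)
        (Set.Ioo ((n : ℝ) * Real.log (1 / q)) (((n : ℝ) + 1) * Real.log (1 / q)))) ∧
      ∀ n : ℕ, 1 ≤ n → ∃ dr dl : ℝ,
        HasDerivWithinAt (g q) dr (Set.Ici ((n : ℝ) * Real.log (1 / q)))
          ((n : ℝ) * Real.log (1 / q)) ∧
        HasDerivWithinAt (g q) dl (Set.Iic ((n : ℝ) * Real.log (1 / q)))
          ((n : ℝ) * Real.log (1 / q)) ∧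
        dr - dl = q ^ (2 * n) / (1 - q ^ n) := by
  have hL := log_one_div_pos hq0 hq1
  refine ⟨fun n => (contDiff_gPartial q n).contDiffOn.congr
    fun x hx => g_eq_gPartial hq0 hq1 hx.1.le hx.2, fun n hn => ?_⟩
  obtain ⟨m, rfl⟩ := Nat.exists_eq_add_of_le' hn
  set a := ((m + 1 : ℕ) : ℝ) * Real.log (1 / q) with ha
  have hsucc : gPartial q (m + 1) = gPartial q m + gTerm q (m + 1) := by
    ext x
    exact Finset.sum_range_succ _ _
  have hm : HasDerivAt (gPartial q m) (deriv (gPartial q m) a) a :=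
    ((contDiff_gPartial q m).differentiable (by simp) a).hasDerivAt
  have hr : HasDerivAt (gPartial q (m + 1)) _ a :=
    hsucc ▸ hm.add (hasDerivAt_gTerm_knot hq0 hn)
  have hga : g q a = gPartial q (m + 1) a :=
    g_eq_gPartial hq0 hq1 le_rfl (by rw [ha]; nlinarith)
  have hga' : g q a = gPartial q m a := by
    rw [hga, hsucc, Pi.add_apply, gTerm_knot q hn, add_zero]
  refine ⟨_, _, hr.hasDerivWithinAt.congr_of_eventuallyEq ?_ hga,
    hm.hasDerivWithinAt.congr_of_eventuallyEq ?_ hga', add_sub_cancel_left _ _⟩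
  · have hlt : a < (((m + 1 : ℕ) : ℝ) + 1) * Real.log (1 / q) := by rw [ha]; nlinarith
    filter_upwards [self_mem_nhdsWithin, mem_nhdsWithin_of_mem_nhds (Iio_mem_nhds hlt)]
      with x h1 h2 using g_eq_gPartial hq0 hq1 h1 h2
  · have hlt : (m : ℝ) * Real.log (1 / q) < a := by rw [ha]; push_cast; nlinarith
    filter_upwards [self_mem_nhdsWithin, mem_nhdsWithin_of_mem_nhds (Ioi_mem_nhds hlt)]
      with x h1 h2
    rcases (show x ≤ a from h1).eq_or_lt with rfl | h
    · exact hga'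
    · exact g_eq_gPartial hq0 hq1 (le_of_lt h2) (by rw [ha] at h; push_cast at h; exact h)
end
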